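/- Let u and B be as in the context. There exist constants 0 < C₁ ≤ C₂ < 1 and r₀ > 0 such that for every ball B(x₀,r) ⊂ B with x₀ ∈ ∂Ω_u and r ≤ r₀: C₁ ≤ |B(x₀,r) ∩ Ω_u| / |B(x₀,r)| ≤ C₂. -/

import Mathlib

open MeasureTheory Filter Metric Set
open scoped RealInnerProductSpace ENNReal Topology NNReal

noncomputable section

abbrev Euc (d : ℕ) := EuclideanSpace ℝ (Fin d)

variable {d : ℕ}

/-- Real-valued Lebesgue volume of a set. -/
def mvol (s : Set (Euc d)) : ℝ := (volume s).toReal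

/-- Smooth scalar test function compactly supported in `Ω`. -/
def TestFun (Ω : Set (Euc d)) (φ : Euc d → ℝ) : Prop :=
  ContDiff ℝ (⊤ : ℕ∞) φ ∧ HasCompactSupport φ ∧ tsupport φ ⊆ Ω

/-- Smooth vector field compactly supported in `Ω`. -/
def VecTestFun (Ω : Set (Euc d)) (Φ : Euc d → Euc d) : Prop :=
  ContDiff ℝ (⊤ : ℕ∞) Φ ∧ HasCompactSupport Φ ∧ tsupport Φ ⊆ Ω

/-- Membership in `H¹₀(Ω)`, encoded through `L²` integrability of the function and of its
(a.e. defined) gradient, together with approximation in the `H¹` norm by smooth functions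
compactly supported in `Ω`. -/
def MemH10 (Ω : Set (Euc d)) (v : Euc d → ℝ) : Prop :=
  MemLp v 2 (volume : Measure (Euc d)) ∧
  MemLp (fun x => gradient v x) 2 (volume : Measure (Euc d)) ∧
  ∃ φ : ℕ → Euc d → ℝ, (∀ n, TestFun Ω (φ n)) ∧
    Tendsto (fun n => ∫ x, ((v x - φ n x) ^ 2 + ‖gradient v x - gradient (φ n) x‖ ^ 2))
      atTop (nhds 0)

/-- First Dirichlet eigenvalue of `Ω`, via the Rayleigh quotient variational characterization. -/
def lam1 (Ω : Set (Euc d)) : ℝ :=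
  sInf {t : ℝ | ∃ v : Euc d → ℝ, MemH10 Ω v ∧ (∫ x, (v x) ^ 2) = 1 ∧
    t = ∫ x, ‖gradient v x‖ ^ 2}

/-- `u` is a normalized first Dirichlet eigenfunction of `Ω`. -/
def IsFirstEigenfun (Ω : Set (Euc d)) (u : Euc d → ℝ) : Prop :=
  MemH10 Ω u ∧ (∫ x, (u x) ^ 2) = 1 ∧ (∫ x, ‖gradient u x‖ ^ 2) = lam1 Ω ∧
  ∀ φ : Euc d → ℝ, TestFun Ω φ →
    (∫ x, ⟪gradient u x, gradient φ x⟫) = lam1 Ω * ∫ x, u x * φ x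

/-- `Ω` solves the shape optimization problem: it minimizes `λ₁` among open subsets of `D` of
measure `a`. -/
structure IsOptimalShape (D : Set (Euc d)) (a : ℝ) (Ω : Set (Euc d)) : Prop where
  isOpen : IsOpen Ω
  subset : Ω ⊆ D
  meas : mvol Ω = a
  minim : ∀ Ω' : Set (Euc d), IsOpen Ω' → Ω' ⊆ D → mvol Ω' = a → lam1 Ω ≤ lam1 Ω'

/-- `u` is locally Lipschitz continuous in `s`. -/
def LocLipOn (s : Set (Euc d)) (u : Euc d → ℝ) : Prop :=
  ∀ x ∈ s, ∃ t, t ∈ 𝓝 x ∧ t ⊆ s ∧ ∃ K : ℝ≥0, LipschitzOnWith K u t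

/-- Divergence of a vector field. -/
def divg (Φ : Euc d → Euc d) (x : Euc d) : ℝ :=
  ∑ i, fderiv ℝ Φ x (EuclideanSpace.single i 1) i

/-- `Ω` has locally finite perimeter in `D` (its characteristic function has locally bounded
variation in `D`). -/
def HasLocFinPerimeterIn (D Ω : Set (Euc d)) : Prop :=
  ∀ K : Set (Euc d), IsCompact K → K ⊆ D → ∃ C : ℝ,
    ∀ Φ : Euc d → Euc d, VecTestFun K Φ → (∀ x, ‖Φ x‖ ≤ 1) →
      (∫ x in Ω, divg Φ x) ≤ C

/-- The reduced boundary of `Ω`: points where `Ω` blows up to a half space, in the sense that the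
symmetric difference with a half space is of vanishing density. -/
def reducedBoundary (Ω : Set (Euc d)) : Set (Euc d) :=
  {x | ∃ ν : Euc d, ‖ν‖ = 1 ∧
    Tendsto (fun r : ℝ =>
        volume (symmDiff (Ω ∩ ball x r) ({y | ⟪y - x, ν⟫ ≤ 0} ∩ ball x r)) /
          ENNReal.ofReal (r ^ d))
      (𝓝[>] 0) (𝓝 0)}

/-- `S` is an analytic hypersurface in `D`: near each of its points in `D` it is the zero set of
an analytic function with nonvanishing gradient. -/
def IsAnalyticHypersurfaceIn (D S : Set (Euc d)) : Prop :=
  ∀ x ∈ S ∩ D, ∃ U : Set (Euc d), IsOpen U ∧ x ∈ U ∧ U ⊆ D ∧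
    ∃ f : Euc d → ℝ, AnalyticOn ℝ f U ∧ (∀ y ∈ U, fderiv ℝ f y ≠ 0) ∧
      S ∩ U = {y ∈ U | f y = 0}

/-- The functional `J(v) = ∫ |∇v|² - λ ∫ v²`. -/
def Jfun (lam : ℝ) (v : Euc d → ℝ) : ℝ :=
  (∫ x, ‖gradient v x‖ ^ 2) - lam * ∫ x, (v x) ^ 2

/-- `Ω_v = {x ∈ D : v(x) ≠ 0}`. -/
def Om (D : Set (Euc d)) (v : Euc d → ℝ) : Set (Euc d) := {x ∈ D | v x ≠ 0}

/-- The optimal value `λ_a` of `λ₁` among open subsets of `D` of measure `a`. -/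
def lamOpt (D : Set (Euc d)) (a : ℝ) : ℝ :=
  sInf {t : ℝ | ∃ Ω : Set (Euc d), IsOpen Ω ∧ Ω ⊆ D ∧ mvol Ω = a ∧ t = lam1 Ω}

/-- `u` minimizes `J` among functions of `H¹₀(D)` with `|Ω_w| ≤ a`. -/
def IsJMinimizer (D : Set (Euc d)) (a lam : ℝ) (u : Euc d → ℝ) : Prop :=
  MemH10 D u ∧ mvol (Om D u) ≤ a ∧
  ∀ w : Euc d → ℝ, MemH10 D w → mvol (Om D w) ≤ a → Jfun lam u ≤ Jfun lam w

/-- The class `F` of perturbations of `u` supported in `B`. -/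
def Fcal (D B : Set (Euc d)) (u v : Euc d → ℝ) : Prop :=
  MemH10 D v ∧ MemH10 B (fun x => u x - v x)

/-- The set of penalization constants `μ₋` admissible for `h` (inward perturbations). -/
def Mminus (D : Set (Euc d)) (a lam : ℝ) (u : Euc d → ℝ) (B : Set (Euc d)) (h : ℝ) :
    Set ℝ :=
  {μ : ℝ | 0 ≤ μ ∧ ∀ v : Euc d → ℝ, Fcal D B u v →
    a - h ≤ mvol (Om D v) → mvol (Om D v) ≤ a →
    Jfun lam u + μ * mvol (Om D u) ≤ Jfun lam v + μ * mvol (Om D v)}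

/-- The set of penalization constants `μ₊` admissible for `h` (outward perturbations). -/
def Mplus (D : Set (Euc d)) (a lam : ℝ) (u : Euc d → ℝ) (B : Set (Euc d)) (h : ℝ) :
    Set ℝ :=
  {μ : ℝ | 0 ≤ μ ∧ ∀ v : Euc d → ℝ, Fcal D B u v →
    a ≤ mvol (Om D v) → mvol (Om D v) ≤ a + h →
    Jfun lam u + μ * mvol (Om D u) ≤ Jfun lam v + μ * mvol (Om D v)}

/-- `μ₋(h)`: the biggest admissible inward penalization constant. -/
def muMinus (D : Set (Euc d)) (a lam : ℝ) (u : Euc d → ℝ) (B : Set (Euc d)) (h : ℝ) : ℝ :=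
  sSup (Mminus D a lam u B h)

/-- `μ₊(h)`: the smallest admissible outward penalization constant. -/
def muPlus (D : Set (Euc d)) (a lam : ℝ) (u : Euc d → ℝ) (B : Set (Euc d)) (h : ℝ) : ℝ :=
  sInf (Mplus D a lam u B h)

/-- Average of `u` on the sphere `∂B(x,r)`, with respect to the `(d-1)`-Hausdorff measure. -/
def sphAvg (u : Euc d → ℝ) (x : Euc d) (r : ℝ) : ℝ :=
  (∫ y in sphere x r, u y ∂(μH[(d : ℝ) - 1])) / ((μH[(d : ℝ) - 1]) (sphere x r)).toReal

lemma norm_grad_eq (f : Euc d → ℝ) (x : Euc d) : ‖gradient f x‖ = ‖fderiv ℝ f x‖ := by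
  simp [gradient]

lemma grad_sub_norm (f g : Euc d → ℝ) (x : Euc d) :
    ‖gradient f x - gradient g x‖ = ‖fderiv ℝ f x - fderiv ℝ g x‖ := by
  simp only [gradient, ← map_sub, LinearIsometryEquiv.norm_map]

lemma meas_grad (f : Euc d → ℝ) : Measurable (fun x => gradient f x) := by
  unfold gradient
  exact (LinearIsometryEquiv.continuous _).measurable.comp (measurable_fderiv ℝ f)

lemma grad_lip_le {f : Euc d → ℝ} {K : ℝ≥0} (hf : LipschitzWith K f) (x : Euc d) :
    ‖gradient f x‖ ≤ K := by
  rw [norm_grad_eq]; exact norm_fderiv_le_of_lipschitz ℝ hf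

lemma fderiv_conv_lip {ψ : Euc d → ℝ} {K : ℝ≥0} (hψ : LipschitzWith K ψ)
    (f : ContDiffBump (0 : Euc d)) (x : Euc d) :
    HasFDerivAt (convolution (f.normed volume) ψ (ContinuousLinearMap.lsmul ℝ ℝ) volume)
      (convolution (f.normed volume) (fderiv ℝ ψ) (ContinuousLinearMap.lsmul ℝ ℝ) volume x) x := by
  have hfi : Integrable (f.normed volume) volume := f.integrable_normed
  have hfc : Continuous (f.normed volume) := f.continuous_normed
  have key := hasFDerivAt_integral_of_dominated_loc_of_lip (𝕜 := ℝ) (μ := (volume : Measure (Euc d)))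
    (F := fun y t => f.normed volume t • ψ (y - t))
    (F' := fun t => f.normed volume t • fderiv ℝ ψ (x - t))
    (bound := fun t => f.normed volume t * K) (x₀ := x) (s := univ) univ_mem
    (Eventually.of_forall fun y => by
      have := hψ.continuous
      exact Continuous.aestronglyMeasurable (by fun_prop))
    (by
      have := hψ.continuous
      refine Continuous.integrable_of_hasCompactSupport (by fun_prop) ?_
      exact f.hasCompactSupport_normed.smul_right)
    (by
      refine hfc.aestronglyMeasurable.smul ?_
      exact ((measurable_fderiv ℝ ψ).comp (by fun_prop)).aestronglyMeasurable)
    (Eventually.of_forall fun t => by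
      refine LipschitzOnWith.of_dist_le_mul fun y _ z _ => ?_
      have h1 := hψ.dist_le_mul (y - t) (z - t)
      have h0 : 0 ≤ f.normed volume t := f.nonneg_normed t
      simp only [Real.coe_nnabs, smul_eq_mul, dist_sub_right] at h1 ⊢
      rw [Real.dist_eq] at h1 ⊢
      rw [← mul_sub, abs_mul, abs_mul, abs_of_nonneg h0, NNReal.abs_eq, mul_assoc]
      gcongr)
    (hfi.mul_const _)
    (by
      have h := hψ.ae_differentiableAt (μ := (volume : Measure (Euc d)))
      have h2 := (Measure.measurePreserving_sub_left (volume : Measure (Euc d)) x).quasiMeasurePreserving.ae h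
      filter_upwards [h2] with t ht
      have h3 : HasFDerivAt (fun y => ψ (y - t)) (fderiv ℝ ψ (x - t)) x := by
        have := ht.hasFDerivAt.comp x ((hasFDerivAt_id x).sub_const t)
        simp only [ContinuousLinearMap.comp_id] at this
        exact this
      exact HasFDerivAt.fun_const_smul h3 _)
  exact key.2

lemma memLp_of_bdd_supp {E : Type*} [NormedAddCommGroup E] {f : Euc d → E} {p : ℝ≥0∞}
    (hf : AEStronglyMeasurable f volume) {S : Set (Euc d)} (hS : IsCompact S) (C : ℝ)
    (hb : ∀ x, ‖f x‖ ≤ C) (h0 : ∀ x, x ∉ S → f x = 0) : MemLp f p volume := by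
  have h1 : f = S.indicator f := by
    ext x; by_cases hx : x ∈ S <;> simp [hx, h0]
  rw [h1, memLp_indicator_iff_restrict hS.measurableSet]
  have : IsFiniteMeasure ((volume : Measure (Euc d)).restrict S) :=
    ⟨by simpa using hS.measure_lt_top⟩
  exact MemLp.of_bound hf.restrict C (Eventually.of_forall hb)

lemma grad_zero_off {ψ : Euc d → ℝ} {x : Euc d} (h : x ∉ tsupport ψ) : gradient ψ x = 0 := by
  have : ψ =ᶠ[𝓝 x] 0 := notMem_tsupport_iff_eventuallyEq.1 h
  simpa [gradient] using congrArg (InnerProductSpace.toDual ℝ (Euc d)).symm (this.fderiv_eq (𝕜 := ℝ))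

lemma fderiv_zero_off {ψ : Euc d → ℝ} {x : Euc d} (h : x ∉ tsupport ψ) : fderiv ℝ ψ x = 0 := by
  have : ψ =ᶠ[𝓝 x] 0 := notMem_tsupport_iff_eventuallyEq.1 h
  simpa using (this.fderiv_eq (𝕜 := ℝ))

lemma memH10_of_lip {U : Set (Euc d)} (hU : IsOpen U) {ψ : Euc d → ℝ} {K : ℝ≥0}
    (hψ : LipschitzWith K ψ) (hc : HasCompactSupport ψ) (hs : tsupport ψ ⊆ U) : MemH10 U ψ := by
  refine ⟨hψ.continuous.memLp_of_hasCompactSupport hc, ?_, ?_⟩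
  · exact memLp_of_bdd_supp (meas_grad ψ).aestronglyMeasurable hc.isCompact K (grad_lip_le hψ)
      (fun x hx => grad_zero_off hx)
  · obtain ⟨ε, hε, hεU⟩ := hc.exists_cthickening_subset_open hU hs
    let f : ℕ → ContDiffBump (0 : Euc d) := fun n =>
      ⟨ε / (2 * (n + 1)), ε / (n + 1), by positivity, by
        apply div_lt_div_of_pos_left hε (by positivity)
        have : (0:ℝ) ≤ n := by positivity
        linarith⟩
    have hfo : ∀ n, (f n).rOut = ε / (n + 1) := fun n => rfl
    have hfε : ∀ n, (f n).rOut ≤ ε := fun n => by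
      rw [hfo]; apply div_le_self hε.le
      have : (0:ℝ) ≤ n := by positivity
      linarith
    let φ : ℕ → Euc d → ℝ := fun n =>
      convolution ((f n).normed volume) ψ (ContinuousLinearMap.lsmul ℝ ℝ) volume
    have hsupp : ∀ n, tsupport (φ n) ⊆ cthickening ε (tsupport ψ) := by
      intro n
      refine closure_minimal ?_ isClosed_cthickening
      refine (support_convolution_subset _).trans ?_
      rintro x ⟨p, hp, q, hq, rfl⟩
      refine mem_cthickening_of_dist_le _ q _ _ (subset_tsupport _ hq) ?_
      have : p ∈ ball (0 : Euc d) (f n).rOut := by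
        rw [← (f n).support_normed_eq (μ := volume)]; exact hp
      simp at this ⊢
      exact this.le.trans (hfε n)
    have hcc : IsCompact (cthickening ε (tsupport ψ)) := hc.isCompact.cthickening
    have hφc : ∀ n, HasCompactSupport (φ n) := fun n =>
      hcc.of_isClosed_subset (isClosed_tsupport _) (hsupp n)
    have hfd : ∀ n x, fderiv ℝ (φ n) x = convolution ((f n).normed volume) (fderiv ℝ ψ)
      (ContinuousLinearMap.lsmul ℝ ℝ) volume x := fun n x => (fderiv_conv_lip hψ (f n) x).fderiv
    refine ⟨φ, fun n => ⟨?_, hφc n, (hsupp n).trans hεU⟩, ?_⟩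
    · exact (f n).hasCompactSupport_normed.contDiff_convolution_left _ (f n).contDiff_normed
        hψ.continuous.locallyIntegrable
    have hlim : Tendsto (fun n => (f n).rOut) atTop (𝓝 0) := by
      simp only [hfo]
      exact tendsto_const_div_atTop_nhds_zero_nat ε |>.comp (tendsto_add_atTop_nat 1) |>.congr (by intro n; simp)
    have hae := ContDiffBump.ae_convolution_tendsto_right_of_locallyIntegrable
      (μ := (volume : Measure (Euc d))) (φ := f) (K := 2) hlim (Eventually.of_forall fun n => by
        show ε / (n + 1) ≤ 2 * (ε / (2 * (n + 1)))
        apply le_of_eq; field_simp) (g := fderiv ℝ ψ) (by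
        refine Integrable.locallyIntegrable (memLp_one_iff_integrable.1 ?_)
        exact memLp_of_bdd_supp (measurable_fderiv ℝ ψ).aestronglyMeasurable hc.isCompact K
          (fun x => norm_fderiv_le_of_lipschitz ℝ hψ) (fun x hx => fderiv_zero_off hx))
    have hclose : ∀ n x, |ψ x - φ n x| ≤ K * (f n).rOut := by
      intro n x
      have := (f n).dist_normed_convolution_le (μ := volume) (g := ψ) (x₀ := x) (ε := K * (f n).rOut)
        hψ.continuous.aestronglyMeasurable (fun y hy => by
          refine (hψ.dist_le_mul y x).trans ?_
          gcongr
          exact (mem_ball.1 hy).le)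
      rw [dist_comm, Real.dist_eq] at this
      exact this
    have hgb : ∀ n x, ‖fderiv ℝ (φ n) x‖ ≤ K := by
      intro n x
      rw [hfd]
      unfold convolution
      have h1 : (∫ t, (f n).normed volume t * (K:ℝ)) = K := by
        rw [integral_mul_const, (f n).integral_normed, one_mul]
      rw [← h1]
      refine norm_integral_le_of_norm_le ((f n).integrable_normed.mul_const _) ?_
      refine Eventually.of_forall fun t => ?_
      have h0 : 0 ≤ (f n).normed volume t := (f n).nonneg_normed t
      simp only [ContinuousLinearMap.lsmul_apply, norm_smul, Real.norm_eq_abs, abs_of_nonneg h0]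
      gcongr
      exact norm_fderiv_le_of_lipschitz ℝ hψ
    have hdom : Tendsto (fun n => ∫ x, ((ψ x - φ n x) ^ 2 + ‖gradient ψ x - gradient (φ n) x‖ ^ 2))
      atTop (nhds (∫ x : Euc d, (0:ℝ))) := by
      refine tendsto_integral_of_dominated_convergence
        ((cthickening ε (tsupport ψ)).indicator (fun _ => (K * ε) ^ 2 + (2 * (K:ℝ)) ^ 2)) ?_ ?_ ?_ ?_
      · intro n
        have h1 : Continuous (φ n) := by
          have := ((f n).hasCompactSupport_normed (μ := volume)).contDiff_convolution_left (n := 0)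
            (ContinuousLinearMap.lsmul ℝ ℝ) (f n).contDiff_normed
            (hψ.continuous.locallyIntegrable (μ := volume))
          exact this.continuous
        have h2 := hψ.continuous
        exact (((h2.sub h1).pow 2).measurable.add
          (((meas_grad ψ).sub (meas_grad (φ n))).norm.pow_const 2)).aestronglyMeasurable
      · refine IntegrableOn.integrable_indicator ?_ hcc.measurableSet
        exact integrableOn_const hcc.measure_lt_top.ne
      · intro n
        refine Eventually.of_forall fun x => ?_
        by_cases hx : x ∈ cthickening ε (tsupport ψ)
        · rw [indicator_of_mem hx, Real.norm_eq_abs, abs_of_nonneg (by positivity)]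
          have h1 : |ψ x - φ n x| ≤ K * ε := (hclose n x).trans (by gcongr; exact hfε n)
          have h2 : ‖gradient ψ x - gradient (φ n) x‖ ≤ 2 * K := by
            refine (norm_sub_le _ _).trans ?_
            have := grad_lip_le hψ x
            have h3 := hgb n x
            rw [← norm_grad_eq] at h3
            linarith
          rw [← sq_abs (ψ x - φ n x)]
          gcongr
        · have h1 : x ∉ tsupport ψ := fun h => hx (self_subset_cthickening _ h)
          have h2 : x ∉ tsupport (φ n) := fun h => hx (hsupp n h)
          rw [indicator_of_notMem hx, grad_zero_off h1, grad_zero_off h2,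
            image_eq_zero_of_notMem_tsupport h1, image_eq_zero_of_notMem_tsupport h2]
          simp
      · filter_upwards [hae] with x hx
        have h1 : Tendsto (fun n => ψ x - φ n x) atTop (𝓝 0) := by
          refine squeeze_zero_norm (fun n => hclose n x) ?_
          simpa using hlim.const_mul (K:ℝ)
        have h2 : Tendsto (fun n => ‖gradient ψ x - gradient (φ n) x‖) atTop (𝓝 0) := by
          simp only [grad_sub_norm, hfd]
          simpa using ((tendsto_const_nhds (x := fderiv ℝ ψ x)).sub hx).norm
        simpa using (h1.pow 2).add (h2.pow 2)
    simpa using hdom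

lemma hasGrad {f : Euc d → ℝ} {x : Euc d} {f' : Euc d →L[ℝ] ℝ} (h : HasFDerivAt f f' x) :
    gradient f x = (InnerProductSpace.toDual ℝ (Euc d)).symm f' := by
  rw [gradient, h.fderiv]

lemma grad_sub_at {f g : Euc d → ℝ} {x : Euc d} (s : ℝ) (hf : DifferentiableAt ℝ f x)
    (hg : DifferentiableAt ℝ g x) :
    gradient (fun y => f y - s * g y) x = gradient f x - s • gradient g x := by
  rw [hasGrad (hf.hasFDerivAt.fun_sub (hg.hasFDerivAt.const_mul s))]
  simp [gradient]

lemma grad_mul_at {f g : Euc d → ℝ} {x : Euc d} (hf : DifferentiableAt ℝ f x)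
    (hg : DifferentiableAt ℝ g x) :
    gradient (fun y => f y * g y) x = f x • gradient g x + g x • gradient f x := by
  rw [hasGrad (hf.hasFDerivAt.fun_mul hg.hasFDerivAt)]
  simp [gradient]

lemma grad_comp_at {f : Euc d → ℝ} {x : Euc d} {h : ℝ → ℝ} {c : ℝ} (hh : HasDerivAt h c (f x))
    (hf : DifferentiableAt ℝ f x) :
    gradient (fun y => h (f y)) x = c • gradient f x := by
  rw [hasGrad (f := fun y => h (f y)) (hh.comp_hasFDerivAt x hf.hasFDerivAt)]
  simp [gradient]

lemma grad_zero_of_min {f : Euc d → ℝ} {x : Euc d} (h : ∀ y, f x ≤ f y) : gradient f x = 0 := by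
  have : IsLocalMin f x := Eventually.of_forall h
  rw [gradient, this.fderiv_eq_zero, map_zero]

/-- admissible test functions -/
def Adm (B : Set (Euc d)) (φ : Euc d → ℝ) : Prop :=
  (∃ K : ℝ≥0, LipschitzWith K φ) ∧ HasCompactSupport φ ∧ tsupport φ ⊆ B

structure Setup (D B : Set (Euc d)) (lam : ℝ) (u : Euc d → ℝ) : Prop where
  hD : IsOpen D
  hB : IsOpen B
  hBD : B ⊆ D
  hu : MemH10 D u
  hnn : ∀ x, 0 ≤ u x
  hlip : LocLipOn D u
  hlam : 0 ≤ lam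
  hfin : volume D ≠ ∞
  hmin : ∀ w : Euc d → ℝ, MemH10 D w → mvol (Om D w) ≤ mvol (Om D u) → Jfun lam u ≤ Jfun lam w

lemma ae_diff {D : Set (Euc d)} {u : Euc d → ℝ} (hlip : LocLipOn D u) :
    ∀ᵐ x, x ∈ D → DifferentiableAt ℝ u x := by
  rw [ae_iff]
  apply measure_null_of_locally_null
  intro x hx
  simp only [mem_ofPred_eq, Classical.not_imp] at hx
  obtain ⟨t, ht, -, K, hK⟩ := hlip x hx.1
  refine ⟨interior t ∩ {x | ¬(x ∈ D → DifferentiableAt ℝ u x)},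
    mem_nhdsWithin.2 ⟨interior t, isOpen_interior, mem_interior_iff_mem_nhds.2 ht, subset_rfl⟩, ?_⟩
  have h := hK.ae_differentiableWithinAt_of_mem (μ := (volume : Measure (Euc d)))
  rw [ae_iff] at h
  refine measure_mono_null ?_ h
  rintro y ⟨hy, hy2⟩
  simp only [mem_ofPred_eq, Classical.not_imp] at hy2 ⊢
  exact ⟨interior_subset hy, fun h => hy2.2 (h.differentiableAt (mem_interior_iff_mem_nhds.1 hy))⟩

lemma Adm.smul {B : Set (Euc d)} {φ : Euc d → ℝ} (h : Adm B φ) (s : ℝ) :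
    Adm B (fun x => s * φ x) := by
  obtain ⟨⟨K, hK⟩, hc, hs⟩ := h
  refine ⟨⟨Real.nnabs s * K, ?_⟩, hc.mul_left, (tsupport_mul_subset_right).trans hs⟩
  refine LipschitzWith.of_dist_le_mul fun x y => ?_
  have := hK.dist_le_mul x y
  rw [Real.dist_eq] at this ⊢
  rw [← mul_sub, abs_mul]
  rw [NNReal.coe_mul, Real.coe_nnabs, mul_assoc]; gcongr

lemma Adm.bdd {B : Set (Euc d)} {φ : Euc d → ℝ} (h : Adm B φ) : ∃ N : ℝ, 0 ≤ N ∧ ∀ x, |φ x| ≤ N := by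
  obtain ⟨⟨K, hK⟩, hc, hs⟩ := h
  obtain ⟨N, hN⟩ := hc.exists_bound_of_continuous hK.continuous
  exact ⟨N, (norm_nonneg _).trans (hN 0), hN⟩

lemma Adm.mul {B : Set (Euc d)} {φ f : Euc d → ℝ} (h : Adm B φ) {K N : ℝ≥0} (hf : LipschitzWith K f)
    (hfb : ∀ x, |f x| ≤ N) : Adm B (fun x => f x * φ x) := by
  obtain ⟨N', hN', hb⟩ := h.bdd
  obtain ⟨⟨K', hK'⟩, hc, hs⟩ := h
  lift N' to ℝ≥0 using hN'
  refine ⟨⟨K * N' + N * K', ?_⟩, hc.mul_left, (tsupport_mul_subset_right).trans hs⟩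
  refine LipschitzWith.of_dist_le_mul fun x y => ?_
  have h1 := hK'.dist_le_mul x y
  have h2 := hf.dist_le_mul x y
  rw [Real.dist_eq] at h1 h2 ⊢
  have : f x * φ x - f y * φ y = (f x - f y) * φ x + f y * (φ x - φ y) := by ring
  rw [this]
  refine (abs_add_le _ _).trans ?_
  rw [abs_mul, abs_mul]
  push_cast
  calc _ ≤ (K * dist x y) * N' + N * (K' * dist x y) := by
        gcongr
        · exact hb x
        · exact hfb y
    _ = _ := by ring

lemma integrable_inner_of {f g : Euc d → Euc d} (hf : MemLp f 2 volume) (hg : MemLp g 2 volume) :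
    Integrable (fun x => ⟪f x, g x⟫) volume := by
  have h := MemLp.integrable_mul hf.norm hg.norm
  refine h.mono' (hf.1.inner hg.1) (Eventually.of_forall fun x => ?_)
  exact norm_inner_le_norm _ _

lemma Adm.memH10 {B : Set (Euc d)} (hB : IsOpen B) {φ : Euc d → ℝ} (h : Adm B φ) : MemH10 B φ := by
  obtain ⟨⟨K, hK⟩, hc, hs⟩ := h
  exact memH10_of_lip hB hK hc hs

namespace Setup
variable {D B : Set (Euc d)} {lam : ℝ} {u : Euc d → ℝ}

lemma grad_ae (S : Setup D B lam u) {φ : Euc d → ℝ} (h : Adm B φ) :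
    ∀ᵐ x, (x ∈ tsupport φ → DifferentiableAt ℝ u x) ∧ DifferentiableAt ℝ φ x := by
  obtain ⟨⟨K, hK⟩, hc, hs⟩ := h
  filter_upwards [ae_diff S.hlip, hK.ae_differentiableAt (μ := volume)] with x hx hx2
  exact ⟨fun h => hx (S.hBD (hs h)), hx2⟩

lemma grad_sub (S : Setup D B lam u) {φ : Euc d → ℝ} (h : Adm B φ) (s : ℝ) :
    ∀ᵐ x, gradient (fun y => u y - s * φ y) x = gradient u x - s • gradient φ x := by
  filter_upwards [S.grad_ae h] with x hx
  by_cases hxs : x ∈ tsupport φ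
  · exact grad_sub_at s (hx.1 hxs) hx.2
  · have h1 : φ =ᶠ[𝓝 x] 0 := notMem_tsupport_iff_eventuallyEq.1 hxs
    have h2 : (fun y => u y - s * φ y) =ᶠ[𝓝 x] u := by
      filter_upwards [h1] with y hy
      simp [hy]
    rw [h2.gradient_eq, grad_zero_off hxs]; simp

lemma memH10_sub (S : Setup D B lam u) {φ : Euc d → ℝ} (h : Adm B φ) (s : ℝ) : MemH10 D (fun y => u y - s * φ y) := by
  obtain ⟨hu1, hu2, p, hp, hpl⟩ := S.hu
  obtain ⟨hv1, hv2, q, hq, hql⟩ := (h.smul s).memH10 S.hB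
  have hg : ∀ᵐ x, gradient (fun y => u y - s * φ y) x = gradient u x - gradient (fun y => s * φ y) x := by
    filter_upwards [S.grad_sub h s, S.grad_ae h] with x hx hx2
    rw [hx, ← sub_eq_zero]
    have := grad_sub_at (f := fun _ : Euc d => (0:ℝ)) (-s) (differentiableAt_const 0) hx2.2
    simp at this
    simp [this]
  have hm : ∀ n, Differentiable ℝ (p n) := fun n => (hp n).1.differentiable (by simp)
  have hm' : ∀ n, Differentiable ℝ (q n) := fun n => (hq n).1.differentiable (by simp)
  have hlp : ∀ {Ω : Set (Euc d)} {f : Euc d → ℝ}, TestFun Ω f → MemLp f 2 volume ∧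
      MemLp (fun x => gradient f x) 2 volume := by
    intro Ω f hf
    have hc : Continuous (fun x => gradient f x) := by
      unfold gradient
      exact (LinearIsometryEquiv.continuous _).comp (hf.1.continuous_fderiv (by simp))
    refine ⟨hf.1.continuous.memLp_of_hasCompactSupport hf.2.1, hc.memLp_of_hasCompactSupport ?_⟩
    refine hf.2.1.mono' ?_
    intro x hx
    by_contra h
    exact hx (grad_zero_off h)
  have hint : ∀ {Ω : Set (Euc d)} {f g : Euc d → ℝ}, MemLp f 2 volume →
      MemLp (fun x => gradient f x) 2 volume → TestFun Ω g →
      Integrable (fun x => (f x - g x) ^ 2 + ‖gradient f x - gradient g x‖ ^ 2) volume := by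
    intro Ω f g hf hf' hg
    have h1 := (hf.sub (hlp hg).1).integrable_norm_pow (by norm_num)
    have h2 := (hf'.sub (hlp hg).2).integrable_norm_pow (by norm_num)
    simp only [Pi.sub_apply, Real.norm_eq_abs, sq_abs] at h1 h2
    exact h1.add h2
  have hL2 : MemLp (fun x => gradient (fun y => u y - s * φ y) x) 2 volume :=
    (hu2.sub hv2).ae_eq (by filter_upwards [hg] with x hx; rw [hx]; rfl)
  refine ⟨hu1.sub hv1, hL2, fun n x => p n x - q n x, fun n => ?_, ?_⟩
  · refine ⟨(hp n).1.sub (hq n).1, (hp n).2.1.sub (hq n).2.1, ?_⟩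
    refine (tsupport_sub _ _).trans (union_subset (hp n).2.2 ((hq n).2.2.trans S.hBD))
  · have hlim : Tendsto (fun n => 2 * (∫ x, ((u x - p n x) ^ 2 + ‖gradient u x - gradient (p n) x‖ ^ 2))
      + 2 * ∫ x, ((s * φ x - q n x) ^ 2 + ‖gradient (fun y => s * φ y) x - gradient (q n) x‖ ^ 2))
        atTop (𝓝 0) := by
      simpa using (hpl.const_mul 2).add (hql.const_mul 2)
    refine squeeze_zero (fun n => integral_nonneg fun x => by positivity) (fun n => ?_) hlim
    rw [← integral_const_mul, ← integral_const_mul, ← integral_add]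
    · refine integral_mono_of_nonneg (Eventually.of_forall fun x => by positivity) ?_ ?_
      · exact ((hint hu1 hu2 (hp n)).const_mul 2).add ((hint hv1 hv2 (hq n)).const_mul 2)
      · filter_upwards [hg] with x hx
        have h3 : gradient (fun x => p n x - q n x) x = gradient (p n) x - gradient (q n) x := by
          have := grad_sub_at 1 (hm n x) (hm' n x)
          simpa using this
        rw [hx, h3]
        have e1 : u x - s * φ x - (p n x - q n x) = (u x - p n x) - (s * φ x - q n x) := by ring
        have e2 : gradient u x - gradient (fun y => s * φ y) x - (gradient (p n) x - gradient (q n) x)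
          = (gradient u x - gradient (p n) x) - (gradient (fun y => s * φ y) x - gradient (q n) x) := by
          abel
        rw [e1, e2]
        set A := gradient u x - gradient (p n) x
        set A' := gradient (fun y => s * φ y) x - gradient (q n) x
        have e3 := parallelogram_law_with_norm ℝ A A'
        have e4 := norm_nonneg (A + A')
        nlinarith [sq_nonneg (u x - p n x + (s * φ x - q n x))]
    · exact (hint hu1 hu2 (hp n)).const_mul 2
    · exact (hint hv1 hv2 (hq n)).const_mul 2

lemma fcal (S : Setup D B lam u) {φ : Euc d → ℝ} (h : Adm B φ) (s : ℝ) : Fcal D B u (fun y => u y - s * φ y) := by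
  refine ⟨S.memH10_sub h s, ?_⟩
  have : (fun x => u x - (u x - s * φ x)) = fun x => s * φ x := by ext x; ring
  rw [this]
  exact (h.smul s).memH10 S.hB

lemma Jexp (S : Setup D B lam u) {φ : Euc d → ℝ} (h : Adm B φ) (s : ℝ) : Jfun lam (fun y => u y - s * φ y) =
    Jfun lam u - 2 * s * ((∫ x, ⟪gradient u x, gradient φ x⟫) - lam * ∫ x, u x * φ x)
      + s ^ 2 * Jfun lam φ := by
  obtain ⟨hu1, hu2, -⟩ := S.hu
  obtain ⟨hv1, hv2, -⟩ := h.memH10 S.hB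
  have i1 : Integrable (fun x => ‖gradient u x‖ ^ 2) volume := hu2.integrable_norm_pow (by norm_num)
  have i2 : Integrable (fun x => ‖gradient φ x‖ ^ 2) volume := hv2.integrable_norm_pow (by norm_num)
  have i3 : Integrable (fun x => (u x) ^ 2) volume := by
    simpa using hu1.integrable_norm_pow (p := 2) (by norm_num)
  have i4 : Integrable (fun x => (φ x) ^ 2) volume := by
    simpa using hv1.integrable_norm_pow (p := 2) (by norm_num)
  have i5 := integrable_inner_of hu2 hv2
  have i6 : Integrable (fun x => u x * φ x) volume := MemLp.integrable_mul hu1 hv1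
  have e1 : (∫ x, ‖gradient (fun y => u y - s * φ y) x‖ ^ 2) = (∫ x, ‖gradient u x‖ ^ 2)
      - 2 * s * (∫ x, ⟪gradient u x, gradient φ x⟫) + s ^ 2 * ∫ x, ‖gradient φ x‖ ^ 2 := by
    rw [← integral_const_mul, ← integral_const_mul, ← integral_sub i1 (i5.const_mul _),
      ← integral_add (by exact i1.sub (i5.const_mul _)) (i2.const_mul _)]
    refine integral_congr_ae ?_
    filter_upwards [S.grad_sub h s] with x hx
    rw [hx, norm_sub_sq_real, inner_smul_right, norm_smul, mul_pow, Real.norm_eq_abs, sq_abs]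
    ring
  have e2 : (∫ x, (u x - s * φ x) ^ 2) = (∫ x, (u x) ^ 2)
      - 2 * s * (∫ x, u x * φ x) + s ^ 2 * ∫ x, (φ x) ^ 2 := by
    rw [← integral_const_mul, ← integral_const_mul, ← integral_sub i3 (i6.const_mul _),
      ← integral_add (by exact i3.sub (i6.const_mul _)) (i4.const_mul _)]
    refine integral_congr_ae (Eventually.of_forall fun x => ?_)
    simp only []
    ring
  unfold Jfun
  rw [e1, e2]; ring

lemma om_ne_top (S : Setup D B lam u) (v : Euc d → ℝ) : volume (Om D v) ≠ ∞ :=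
  ne_top_of_le_ne_top S.hfin (measure_mono fun _ h => h.1)

lemma euler (S : Setup D B lam u) {φ : Euc d → ℝ} (h : Adm B φ) (h0 : ∀ x ∈ D, u x = 0 → φ x = 0) :
    (∫ x, ⟪gradient u x, gradient φ x⟫) = lam * ∫ x, u x * φ x := by
  have key : ∀ s : ℝ, 0 ≤ - 2 * s * ((∫ x, ⟪gradient u x, gradient φ x⟫) - lam * ∫ x, u x * φ x)
      + s ^ 2 * Jfun lam φ := by
    intro s
    have h1 := S.hmin _ (S.memH10_sub h s) (by
      refine ENNReal.toReal_mono (S.om_ne_top u) (measure_mono ?_)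
      rintro x ⟨hx, hx2⟩
      refine ⟨hx, fun hux => hx2 ?_⟩
      simp [hux, h0 x hx hux])
    rw [S.Jexp h s] at h1
    linarith
  set X := (∫ x, ⟪gradient u x, gradient φ x⟫) - lam * ∫ x, u x * φ x with hX
  suffices X = 0 by linarith
  set Q := Jfun lam φ
  have hd := discrim_le_zero (a := Q) (b := -2 * X) (c := 0) (fun s => by have := key s; nlinarith)
  unfold discrim at hd
  nlinarith [sq_nonneg X]

/-- a globally Lipschitz bounded extension of `u` from a closed ball -/
lemma ext (S : Setup D B lam u) {x : Euc d} {t : ℝ} (hb : closedBall x t ⊆ D) : ∃ K N : ℝ≥0, ∃ f : Euc d → ℝ,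
    LipschitzWith K f ∧ (∀ y, 0 ≤ f y) ∧ (∀ y, f y ≤ N) ∧ ∀ y ∈ closedBall x t, u y = f y := by
  have hll : LocallyLipschitzOn (closedBall x t) u := by
    intro y hy
    obtain ⟨s, hs, -, K, hK⟩ := S.hlip y (hb hy)
    exact ⟨K, s, mem_nhdsWithin_of_mem_nhds hs, hK⟩
  obtain ⟨K, hK⟩ := LocallyLipschitzOn.exists_lipschitzOnWith_of_compact (isCompact_closedBall x t) hll
  obtain ⟨N, hN⟩ := (isCompact_closedBall x t).exists_bound_of_continuousOn hK.continuousOn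
  obtain ⟨g, hg, hge⟩ := hK.extend_real
  refine ⟨K, Real.toNNReal N, fun y => max 0 (min (g y) (Real.toNNReal N)), ?_, fun y => le_max_left _ _,
    fun y => max_le (by positivity) (min_le_right _ _), fun y hy => ?_⟩
  · exact (hg.min_const _).const_max 0
  · have h1 := hN y hy
    rw [Real.norm_eq_abs, abs_of_nonneg (S.hnn y)] at h1
    show u y = max 0 (min (g y) (Real.toNNReal N))
    rw [← hge hy, min_eq_left (h1.trans (Real.le_coe_toNNReal N)), max_eq_right (S.hnn y)]

end Setup

def psi (x : Euc d) (t : ℝ) (y : Euc d) : ℝ := (t ^ 2 - (min ‖y - x‖ t) ^ 2) / 2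

lemma psi_zero {x : Euc d} {t : ℝ} {y : Euc d} (h : t ≤ ‖y - x‖) : psi x t y = 0 := by
  simp [psi, min_eq_right h]

lemma psi_pos {x : Euc d} {t : ℝ} {y : Euc d} (h : ‖y - x‖ < t) : 0 < psi x t y := by
  unfold psi
  rw [min_eq_left h.le]
  have := norm_nonneg (y - x)
  nlinarith

lemma psi_nonneg (x : Euc d) (t : ℝ) (y : Euc d) : 0 ≤ psi x t y := by
  rcases le_or_gt t ‖y - x‖ with h | h
  · rw [psi_zero h]
  · exact (psi_pos h).le

lemma psi_le (x : Euc d) (t : ℝ) (y : Euc d) : psi x t y ≤ t ^ 2 / 2 := by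
  unfold psi
  have := sq_nonneg (min ‖y - x‖ t)
  linarith

lemma psi_tsupport (x : Euc d) (t : ℝ) : tsupport (psi x t) ⊆ closedBall x t := by
  refine closure_minimal ?_ isClosed_closedBall
  intro y hy
  by_contra h
  apply hy
  rw [mem_closedBall, not_le, dist_eq_norm] at h
  exact psi_zero h.le

lemma psi_adm {B : Set (Euc d)} {x : Euc d} {t : ℝ} (ht : 0 < t) (h : closedBall x t ⊆ B) :
    Adm B (psi x t) := by
  refine ⟨⟨Real.toNNReal t, ?_⟩, ?_, (psi_tsupport x t).trans h⟩
  · refine LipschitzWith.of_dist_le_mul fun y z => ?_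
    rw [Real.coe_toNNReal _ ht.le, Real.dist_eq]
    have h1 : |min ‖y - x‖ t - min ‖z - x‖ t| ≤ dist y z := by
      have e : LipschitzWith 1 (fun y : Euc d => min ‖y - x‖ t) := by
        have : LipschitzWith 1 (fun y : Euc d => ‖y - x‖) := by
          simpa [dist_eq_norm] using LipschitzWith.dist_left x
        exact this.min_const t
      simpa [Real.dist_eq] using e.dist_le_mul y z
    have h2 : min ‖y - x‖ t ≤ t := min_le_right _ _
    have h3 : min ‖z - x‖ t ≤ t := min_le_right _ _
    have h4 : 0 ≤ min ‖y - x‖ t := le_min (norm_nonneg _) ht.le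
    have h5 : 0 ≤ min ‖z - x‖ t := le_min (norm_nonneg _) ht.le
    unfold psi
    set p := min ‖y - x‖ t
    set q := min ‖z - x‖ t
    have : (t ^ 2 - p ^ 2) / 2 - (t ^ 2 - q ^ 2) / 2 = -((p + q) / 2 * (p - q)) := by ring
    rw [this, abs_neg, abs_mul, abs_of_nonneg (by positivity)]
    gcongr
    linarith
  · exact (isCompact_closedBall x t).of_isClosed_subset (isClosed_tsupport _) (psi_tsupport x t)

lemma grad_psi_in {x : Euc d} {t : ℝ} {y : Euc d} (h : y ∈ ball x t) :
    gradient (psi x t) y = -(y - x) := by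
  have h1 : psi x t =ᶠ[𝓝 y] fun z => (t ^ 2 - ‖z - x‖ ^ 2) / 2 := by
    filter_upwards [isOpen_ball.mem_nhds h] with z hz
    rw [mem_ball, dist_eq_norm] at hz
    rw [psi, min_eq_left hz.le]
  rw [h1.gradient_eq]
  have h2 : HasFDerivAt (fun z : Euc d => (t ^ 2 - ‖z - x‖ ^ 2) / 2)
      (InnerProductSpace.toDual ℝ (Euc d) (-(y - x))) y := by
    have h3 := ((hasFDerivAt_id (𝕜 := ℝ) y).sub_const x).norm_sq
    have h4 := (h3.const_sub (t ^ 2)).mul_const (2⁻¹ : ℝ)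
    have h5 : (2⁻¹ : ℝ) • -(2 • (innerSL ℝ (id y - x)).comp (ContinuousLinearMap.id ℝ (Euc d)))
        = InnerProductSpace.toDual ℝ (Euc d) (-(y - x)) := by
      ext v
      simp
    rw [← h5]
    exact h4
  rw [hasGrad h2]; simp

lemma grad_psi_out {x : Euc d} {t : ℝ} {y : Euc d} (h : y ∉ ball x t) :
    gradient (psi x t) y = 0 := by
  rw [mem_ball, not_lt, dist_eq_norm] at h
  apply grad_zero_of_min
  intro z
  rw [psi_zero h]; exact psi_nonneg _ _ _

def MM (u : Euc d → ℝ) (x : Euc d) (t : ℝ) : ℝ := ∫ z in ball (0 : Euc d) 1, u (x + t • z)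

lemma int_ball_scale (g : Euc d → ℝ) (x : Euc d) {t : ℝ} (ht : 0 < t) :
    (∫ y in ball x t, g y) = t ^ d * ∫ z in ball (0 : Euc d) 1, g (x + t • z) := by
  have h1 := Measure.setIntegral_comp_smul_of_pos (volume : Measure (Euc d)) (fun y => g (x + y))
    (ball (0 : Euc d) 1) ht
  rw [h1, smul_unitBall_of_pos ht, finrank_euclideanSpace_fin, smul_eq_mul, ← mul_assoc,
    mul_inv_cancel₀ (by positivity), one_mul]
  have h2 := (measurePreserving_add_left (volume : Measure (Euc d)) x).setIntegral_preimage_emb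
    (MeasurableEquiv.addLeft x).measurableEmbedding g (ball x t)
  rw [← h2]
  congr 2
  ext y; simp

lemma MM_deriv_lip {f : Euc d → ℝ} {K N : ℝ≥0} (hf : LipschitzWith K f) (hN : ∀ y, |f y| ≤ N)
    (x : Euc d) {t : ℝ} (ht : 0 < t) :
    HasDerivAt (MM f x) (∫ z in ball (0 : Euc d) 1, fderiv ℝ f (x + t • z) z) t := by
  have hc := hf.continuous
  have : IsFiniteMeasure ((volume : Measure (Euc d)).restrict (ball 0 1)) :=
    ⟨by simpa using measure_ball_lt_top⟩
  have key := hasDerivAt_integral_of_dominated_loc_of_lip (𝕜 := ℝ)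
    (μ := (volume : Measure (Euc d)).restrict (ball 0 1))
    (F := fun s z => f (x + s • z)) (F' := fun z => fderiv ℝ f (x + t • z) z)
    (bound := fun _ => (K : ℝ)) (x₀ := t) (s := univ) univ_mem
    (Eventually.of_forall fun s => (by fun_prop : Continuous _).aestronglyMeasurable)
    (by
      refine Integrable.of_bound (by fun_prop : Continuous _).aestronglyMeasurable (N : ℝ)
        (Eventually.of_forall fun z => hN _))
    (by
      have h1 : Measurable fun z : Euc d => fderiv ℝ f (x + t • z) :=
        (measurable_fderiv ℝ f).comp (by fun_prop)
      have h2 : Continuous fun p : (Euc d →L[ℝ] ℝ) × Euc d => p.1 p.2 := by fun_prop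
      exact (h2.measurable.comp (h1.prodMk measurable_id)).aestronglyMeasurable)
    (by
      filter_upwards [ae_restrict_mem measurableSet_ball] with z hz
      refine LipschitzOnWith.of_dist_le_mul fun p _ q _ => ?_
      refine (hf.dist_le_mul _ _).trans ?_
      simp only [Real.coe_nnabs, NNReal.abs_eq]
      gcongr
      rw [dist_add_left, dist_eq_norm, ← sub_smul, norm_smul, Real.dist_eq, Real.norm_eq_abs]
      rw [mem_ball_zero_iff] at hz
      exact mul_le_of_le_one_right (abs_nonneg _) hz.le)
    (integrable_const _)
    (by
      refine ae_restrict_of_ae ?_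
      have h := hf.ae_differentiableAt (μ := (volume : Measure (Euc d)))
      have h2 : ∀ᵐ z : Euc d, DifferentiableAt ℝ f (x + t • z) := by
        have h3 := (measurePreserving_add_left (volume : Measure (Euc d)) x).quasiMeasurePreserving.ae h
        rw [ae_iff] at h3 ⊢
        have h4 := Measure.addHaar_preimage_smul (volume : Measure (Euc d)) ht.ne'
          {y | ¬ DifferentiableAt ℝ f (x + y)}
        rw [h3, mul_zero] at h4
        exact h4
      filter_upwards [h2] with z hz
      have h5 : HasDerivAt (fun s : ℝ => x + s • z) z t := by
        simpa using ((hasDerivAt_id t).smul_const z).const_add x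
      exact hz.hasFDerivAt.comp_hasDerivAt t h5)
  exact key.2

lemma MM_cont_lip {f : Euc d → ℝ} {K N : ℝ≥0} (hf : LipschitzWith K f) (hN : ∀ y, |f y| ≤ N)
    (x : Euc d) : Continuous (MM f x) := by
  have hc := hf.continuous
  have : IsFiniteMeasure ((volume : Measure (Euc d)).restrict (ball 0 1)) :=
    ⟨by simpa using measure_ball_lt_top⟩
  refine continuous_of_dominated (bound := fun _ => (N : ℝ))
    (fun s => (by fun_prop : Continuous _).aestronglyMeasurable) (fun s => Eventually.of_forall fun z => hN _)
    (integrable_const _) (Eventually.of_forall fun z => by fun_prop)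

namespace Setup
variable {D B : Set (Euc d)} {lam : ℝ} {u : Euc d → ℝ}

lemma MM_props (S : Setup D B lam u) {x : Euc d} {T : ℝ} (h : closedBall x T ⊆ D) :
    ContinuousOn (MM u x) (Icc 0 T) ∧ ∀ t, 0 < t → t < T → HasDerivAt (MM u x)
      (-((t ^ (d + 1))⁻¹ * ∫ y, ⟪gradient u y, gradient (psi x t) y⟫)) t := by
  obtain ⟨K, N, f, hf, hf0, hfN, hfu⟩ := S.ext h
  have hN : ∀ y, |f y| ≤ N := fun y => by rw [abs_of_nonneg (hf0 y)]; exact hfN y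
  have heq : ∀ t ∈ Icc 0 T, MM u x t = MM f x t := by
    intro t ht
    refine setIntegral_congr_fun measurableSet_ball fun z hz => hfu _ ?_
    rw [mem_ball_zero_iff] at hz
    rw [mem_closedBall, dist_eq_norm, add_sub_cancel_left, norm_smul, Real.norm_eq_abs, abs_of_nonneg ht.1]
    have := mul_le_of_le_one_right ht.1 hz.le
    linarith [ht.2]
  refine ⟨(MM_cont_lip hf hN x).continuousOn.congr heq, fun t ht htT => ?_⟩
  have h1 := MM_deriv_lip hf hN x ht
  have h2 : MM u x =ᶠ[𝓝 t] MM f x := by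
    filter_upwards [Ioo_mem_nhds ht htT] with s hs using heq s ⟨hs.1.le, hs.2.le⟩
  have h3 := h1.congr_of_eventuallyEq h2
  have h4 := int_ball_scale (fun y => fderiv ℝ f y (y - x)) x ht
  have h5 : (∫ z in ball (0 : Euc d) 1, fderiv ℝ f (x + t • z) (x + t • z - x))
      = t * ∫ z in ball (0 : Euc d) 1, fderiv ℝ f (x + t • z) z := by
    rw [← integral_const_mul]
    congr 1; ext z; simp
  rw [h5] at h4
  have h6 : (∫ y, ⟪gradient u y, gradient (psi x t) y⟫) = - ∫ y in ball x t, fderiv ℝ f y (y - x) := by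
    rw [← integral_neg, ← integral_indicator measurableSet_ball]
    congr 1; ext y
    by_cases hy : y ∈ ball x t
    · rw [indicator_of_mem hy, grad_psi_in hy]
      have e : u =ᶠ[𝓝 y] f := by
        filter_upwards [isOpen_ball.mem_nhds hy] with z hz
        exact hfu z (closedBall_subset_closedBall htT.le (ball_subset_closedBall hz))
      rw [e.gradient_eq, inner_neg_right, inner_gradient_left]
    · rw [indicator_of_notMem hy, grad_psi_out hy, inner_zero_right]
  have e : (-((t ^ (d + 1))⁻¹ * ∫ y, ⟪gradient u y, gradient (psi x t) y⟫))
      = ∫ z in ball (0 : Euc d) 1, fderiv ℝ f (x + t • z) z := by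
    rw [h6, h4]
    field_simp
    rw [pow_succ]
  rw [e]; exact h3

end Setup

namespace Setup
variable {D B : Set (Euc d)} {lam : ℝ} {u : Euc d → ℝ}

lemma weak_eps (S : Setup D B lam u) {ψ : Euc d → ℝ} (hψ : Adm B ψ) (hp : ∀ y, 0 ≤ ψ y) {x : Euc d} {t : ℝ}
    (hs : tsupport ψ ⊆ closedBall x t) (hb : closedBall x t ⊆ B) {ε : ℝ} (hε : 0 < ε) :
    (∫ y, u y / (u y + ε) * ⟪gradient u y, gradient ψ y⟫) ≤ lam * ∫ y, u y * ψ y := by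
  obtain ⟨K, N, f, hf, hf0, hfN, hfu⟩ := S.ext (hb.trans S.hBD)
  have hlipg : LipschitzWith (K / Real.toNNReal ε) (fun y => f y / (f y + ε)) := by
    refine LipschitzWith.of_dist_le_mul fun y z => ?_
    have h1 := hf.dist_le_mul y z
    rw [Real.dist_eq] at h1 ⊢
    have hy := hf0 y
    have hz := hf0 z
    have : f y / (f y + ε) - f z / (f z + ε) = (f y - f z) * (ε / ((f y + ε) * (f z + ε))) := by
      field_simp; ring
    rw [this, abs_mul, abs_of_nonneg (a := ε / _) (by positivity), NNReal.coe_div, Real.coe_toNNReal _ hε.le]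
    have h2 : ε / ((f y + ε) * (f z + ε)) ≤ 1 / ε := by
      rw [div_le_div_iff₀ (by positivity) hε]
      nlinarith [mul_nonneg hy hz]
    calc _ ≤ (K * dist y z) * (1 / ε) := by gcongr
      _ = _ := by ring
  have hg1 : ∀ y, |f y / (f y + ε)| ≤ (1 : ℝ≥0) := by
    intro y
    have hy := hf0 y
    rw [abs_of_nonneg (by positivity), NNReal.coe_one, div_le_one (by positivity)]
    linarith
  have hadm0 := hψ.mul hlipg hg1
  have heq : (fun y => f y / (f y + ε) * ψ y) = fun y => u y / (u y + ε) * ψ y := by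
    ext y
    by_cases hy : y ∈ tsupport ψ
    · rw [hfu y (hs hy)]
    · rw [image_eq_zero_of_notMem_tsupport hy]; simp
  rw [heq] at hadm0
  have he := S.euler hadm0 (fun y _ hy => by simp [hy])
  obtain ⟨hu1, hu2, -⟩ := S.hu
  obtain ⟨hv1, hv2, -⟩ := hψ.memH10 S.hB
  obtain ⟨hw1, hw2, -⟩ := hadm0.memH10 S.hB
  have hq : ∀ y, 0 ≤ u y / (u y + ε) ∧ u y / (u y + ε) ≤ 1 := by
    intro y
    have := S.hnn y
    exact ⟨by positivity, by rw [div_le_one (by positivity)]; linarith⟩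
  have i1 : Integrable (fun y => u y / (u y + ε) * ⟪gradient u y, gradient ψ y⟫) volume := by
    have i0 := integrable_inner_of hu2 hv2
    refine i0.bdd_mul (c := 1) ?_ (Eventually.of_forall fun y => ?_)
    · exact (hu1.1.aemeasurable.div (hu1.1.aemeasurable.add_const ε)).aestronglyMeasurable
    · rw [Real.norm_eq_abs, abs_of_nonneg (hq y).1]; exact (hq y).2
  calc _ ≤ ∫ y, ⟪gradient u y, gradient (fun y => u y / (u y + ε) * ψ y) y⟫ := by
        refine integral_mono_ae i1 (integrable_inner_of hu2 hw2) ?_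
        filter_upwards [S.grad_ae hψ] with y hy
        by_cases hys : y ∈ tsupport ψ
        · have hd := hy.1 hys
          have hun := S.hnn y
          have hder : HasDerivAt (fun s : ℝ => s / (s + ε)) (ε / (u y + ε) ^ 2) (u y) := by
            have := (hasDerivAt_id (u y)).div ((hasDerivAt_id (u y)).add_const ε) (by simp; positivity)
            refine this.congr_deriv ?_
            simp
          have h1 := grad_comp_at hder hd
          have hd1 : DifferentiableAt ℝ (fun y => u y / (u y + ε)) y := by
            exact hder.differentiableAt.comp y hd
          have h2 := grad_mul_at hd1 hy.2
          rw [h2, h1, inner_add_right, inner_smul_right, inner_smul_right, inner_smul_right,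
            real_inner_self_eq_norm_sq]
          have := hp y
          have : 0 ≤ ψ y * (ε / (u y + ε) ^ 2 * ‖gradient u y‖ ^ 2) := by positivity
          linarith
        · have h1 : gradient (fun y => u y / (u y + ε) * ψ y) y = 0 :=
            grad_zero_off (fun h => hys (tsupport_mul_subset_right h))
          rw [h1, grad_zero_off hys]; simp
    _ = lam * ∫ y, u y * (u y / (u y + ε) * ψ y) := he
    _ ≤ _ := by
        refine mul_le_mul_of_nonneg_left ?_ S.hlam
        refine integral_mono (MemLp.integrable_mul hu1 hw1) (MemLp.integrable_mul hu1 hv1) fun y => ?_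
        simp only []
        exact mul_le_mul_of_nonneg_left (mul_le_of_le_one_left (hp y) (hq y).2) (S.hnn y)

lemma weak_sub (S : Setup D B lam u) {ψ : Euc d → ℝ} (hψ : Adm B ψ) (hp : ∀ y, 0 ≤ ψ y) {x : Euc d} {t : ℝ}
    (hs : tsupport ψ ⊆ closedBall x t) (hb : closedBall x t ⊆ B) :
    (∫ y, ⟪gradient u y, gradient ψ y⟫) ≤ lam * ∫ y, u y * ψ y := by
  obtain ⟨hu1, hu2, -⟩ := S.hu
  obtain ⟨hv1, hv2, -⟩ := hψ.memH10 S.hB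
  have i0 := integrable_inner_of hu2 hv2
  have hlim : Tendsto (fun n : ℕ => ∫ y, u y / (u y + 1 / ((n : ℝ) + 1)) * ⟪gradient u y, gradient ψ y⟫) atTop
      (𝓝 (∫ y, ⟪gradient u y, gradient ψ y⟫)) := by
    refine tendsto_integral_of_dominated_convergence (fun y => ‖⟪gradient u y, gradient ψ y⟫‖) ?_ i0.norm ?_ ?_
    · intro n
      exact (hu1.1.aemeasurable.div (hu1.1.aemeasurable.add_const _)).aestronglyMeasurable.mul i0.1
    · intro n
      refine Eventually.of_forall fun y => ?_
      rw [norm_mul]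
      have := S.hnn y
      have hn : (0 : ℝ) < 1 / ((n : ℝ) + 1) := by positivity
      refine mul_le_of_le_one_left (norm_nonneg _) ?_
      rw [Real.norm_eq_abs, abs_of_nonneg (by positivity), div_le_one (by positivity)]
      linarith
    · refine Eventually.of_forall fun y => ?_
      rcases (S.hnn y).eq_or_lt with h | h
      · have : gradient u y = 0 := grad_zero_of_min (fun z => by rw [← h]; exact S.hnn z)
        simp [this]
      · have h1 : Tendsto (fun n : ℕ => u y / (u y + 1 / ((n : ℝ) + 1))) atTop (𝓝 (u y / (u y + 0))) :=
          tendsto_const_nhds.div (tendsto_const_nhds.add tendsto_one_div_add_atTop_nhds_zero_nat)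
            (by simpa using h.ne')
        rw [add_zero, div_self h.ne'] at h1
        simpa using h1.mul_const ⟪gradient u y, gradient ψ y⟫
  exact le_of_tendsto hlim (Eventually.of_forall fun n => S.weak_eps hψ hp hs hb (by positivity))

/-- `∫ u ψ_t` bounded by the ball integral -/
lemma int_psi_le (S : Setup D B lam u) {x : Euc d} {t : ℝ} (ht : 0 < t) (hb : closedBall x t ⊆ B) :
    (∫ y, u y * psi x t y) ≤ t ^ 2 / 2 * (t ^ d * MM u x t) := by
  have hu1 := S.hu.1
  have hv1 := ((psi_adm ht hb).memH10 S.hB).1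
  have : (∫ y, u y * psi x t y) = ∫ y in ball x t, u y * psi x t y := by
    rw [← integral_indicator measurableSet_ball]
    congr 1; ext y
    by_cases hy : y ∈ ball x t
    · rw [indicator_of_mem hy]
    · rw [indicator_of_notMem hy]
      rw [mem_ball, not_lt, dist_eq_norm] at hy
      rw [psi_zero hy, mul_zero]
  rw [this, MM, ← int_ball_scale u x ht, ← integral_const_mul]
  have iu : IntegrableOn u (ball x t) volume := by
    have : IsFiniteMeasure ((volume : Measure (Euc d)).restrict (ball x t)) :=
      ⟨by simpa using measure_ball_lt_top⟩
    exact (hu1.restrict (ball x t)).integrable (by norm_num)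
  refine integral_mono (MemLp.integrable_mul hu1 hv1).integrableOn (iu.const_mul _) fun y => ?_
  simp only []
  rw [mul_comm]
  exact mul_le_mul_of_nonneg_right (psi_le x t y) (S.hnn y)

lemma MM_nonneg (S : Setup D B lam u) (x : Euc d) (t : ℝ) : 0 ≤ MM u x t :=
  integral_nonneg fun _ => S.hnn _

lemma iu (S : Setup D B lam u) (x : Euc d) (t : ℝ) : IntegrableOn u (ball x t) volume := by
  have : IsFiniteMeasure ((volume : Measure (Euc d)).restrict (ball x t)) :=
    ⟨by simpa using measure_ball_lt_top⟩
  exact (S.hu.1.restrict (ball x t)).integrable (by norm_num)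

lemma MM_zero (u : Euc d → ℝ) (x : Euc d) : MM u x 0 = mvol (ball (0 : Euc d) 1) * u x := by
  simp [MM, mvol, Measure.real]

lemma sub_mean (S : Setup D B lam u) {x : Euc d} {T : ℝ} (hT : 0 < T) (hb : closedBall x T ⊆ B)
    (hl : lam * T ^ 2 ≤ 1) :
    mvol (ball (0 : Euc d) 1) * u x * T ^ d ≤ 2 * ∫ y in ball x T, u y := by
  obtain ⟨hc, hder⟩ := S.MM_props (hb.trans S.hBD)
  have hmono : MonotoneOn (fun t => MM u x t * (1 + lam * t ^ 2)) (Icc 0 T) := by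
    have hd : ∀ t ∈ Ioo 0 T, HasDerivAt (fun t => MM u x t * (1 + lam * t ^ 2))
        (-((t ^ (d + 1))⁻¹ * ∫ y, ⟪gradient u y, gradient (psi x t) y⟫) * (1 + lam * t ^ 2)
          + MM u x t * (lam * (2 * t))) t := by
      intro t ht
      have h2 : HasDerivAt (fun t : ℝ => 1 + lam * t ^ 2) (lam * (2 * t)) t := by
        simpa using ((hasDerivAt_pow 2 t).const_mul lam).const_add 1
      exact (hder t ht.1 ht.2).mul h2
    refine monotoneOn_of_deriv_nonneg (convex_Icc 0 T) ?_ ?_ ?_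
    · exact hc.mul (by fun_prop)
    · rw [interior_Icc]
      intro t ht
      exact (hd t ht).differentiableAt.differentiableWithinAt
    · rw [interior_Icc]
      intro t ht
      rw [(hd t ht).deriv]
      have ht0 := ht.1
      have hbt : closedBall x t ⊆ B := (closedBall_subset_closedBall ht.2.le).trans hb
      have h1 := S.weak_sub (psi_adm ht0 hbt) (psi_nonneg x t) (psi_tsupport x t) hbt
      have h2 := S.int_psi_le ht0 hbt
      have h3 : (t ^ (d + 1))⁻¹ * (∫ y, ⟪gradient u y, gradient (psi x t) y⟫) ≤ lam * t / 2 * MM u x t := by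
        rw [inv_mul_le_iff₀ (by positivity)]
        refine h1.trans ((mul_le_mul_of_nonneg_left h2 S.hlam).trans (le_of_eq ?_))
        ring
      have h4 := S.MM_nonneg x t
      have h5 := S.hlam
      have h6 : lam * t ^ 2 ≤ 1 := by
        refine le_trans ?_ hl
        have := ht.2.le
        gcongr
      have h7 : 0 ≤ lam * t ^ 2 := by positivity
      have h8 : 0 ≤ lam * t * MM u x t := by positivity
      nlinarith [mul_nonneg h8 (sub_nonneg.2 h6)]
  have h := hmono (left_mem_Icc.2 hT.le) (right_mem_Icc.2 hT.le) hT.le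
  simp only [MM_zero] at h
  have h4 := S.MM_nonneg x T
  rw [int_ball_scale u x hT]
  change _ ≤ 2 * (T ^ d * MM u x T)
  have : mvol (ball (0 : Euc d) 1) * u x ≤ 2 * MM u x T := by nlinarith
  have h9 : 0 < T ^ d := by positivity
  nlinarith

end Setup

lemma mvol_ball (x : Euc d) {t : ℝ} (ht : 0 < t) :
    mvol (ball x t) = mvol (ball (0 : Euc d) 1) * t ^ d := by
  unfold mvol
  rw [Measure.addHaar_ball_of_pos _ _ ht, finrank_euclideanSpace_fin, ENNReal.toReal_mul,
    ENNReal.toReal_ofReal (by positivity), mul_comm]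

lemma om_pos : 0 < mvol (ball (0 : Euc d) 1) :=
  ENNReal.toReal_pos (measure_ball_pos _ _ one_pos).ne' measure_ball_lt_top.ne

lemma mvol_mono {A A' : Set (Euc d)} (h : A ⊆ A') (hf : volume A' ≠ ∞) : mvol A ≤ mvol A' :=
  ENNReal.toReal_mono hf (measure_mono h)

lemma mvol_nonneg (A : Set (Euc d)) : 0 ≤ mvol A := ENNReal.toReal_nonneg

namespace Setup
variable {D B : Set (Euc d)} {lam : ℝ} {u : Euc d → ℝ}

lemma contOn (S : Setup D B lam u) : ContinuousOn u D := by
  intro x hx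
  obtain ⟨t, ht, -, K, hK⟩ := S.hlip x hx
  exact ((hK.continuousOn x (mem_of_mem_nhds ht)).continuousAt ht).continuousWithinAt

lemma om_open (S : Setup D B lam u) : IsOpen (Om D u) := by
  have h := S.contOn.isOpen_inter_preimage S.hD (isOpen_compl_singleton (x := (0 : ℝ)))
  exact h

lemma J_psi_le (S : Setup D B lam u) (x : Euc d) {t : ℝ} (ht : 0 < t) :
    Jfun lam (psi x t) ≤ mvol (ball (0 : Euc d) 1) * t ^ (d + 2) := by
  have h1 : 0 ≤ lam * ∫ y, (psi x t y) ^ 2 :=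
    mul_nonneg S.hlam (integral_nonneg fun _ => sq_nonneg _)
  have h2 : (∫ y, ‖gradient (psi x t) y‖ ^ 2) ≤ ∫ y, (ball x t).indicator (fun _ => t ^ 2) y := by
    refine integral_mono_of_nonneg (Eventually.of_forall fun y => by positivity) ?_
      (Eventually.of_forall fun y => ?_)
    · exact (integrable_indicator_iff measurableSet_ball).2
        (integrableOn_const measure_ball_lt_top.ne)
    · simp only []
      by_cases hy : y ∈ ball x t
      · rw [grad_psi_in hy, indicator_of_mem hy, norm_neg]
        rw [mem_ball, dist_eq_norm] at hy
        gcongr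
      · rw [grad_psi_out hy, indicator_of_notMem hy]; simp
  rw [integral_indicator measurableSet_ball, setIntegral_const, smul_eq_mul] at h2
  have h3 : volume.real (ball x t) = mvol (ball x t) := rfl
  rw [h3, mvol_ball x ht] at h2
  unfold Jfun
  calc _ ≤ mvol (ball (0 : Euc d) 1) * t ^ d * t ^ 2 := by linarith
    _ = _ := by ring

lemma outward (S : Setup D B lam u) {a h μ : ℝ} (hμ : μ ∈ Mplus D a lam u B h) (ha : mvol (Om D u) = a)
    {x : Euc d} {t : ℝ} (ht : 0 < t) (hb : closedBall x t ⊆ B) (hh : mvol (ball x t) ≤ h) {σ : ℝ} (hσ : 0 < σ) :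
    2 * σ * (-((t ^ (d + 1))⁻¹ * ∫ y, ⟪gradient u y, gradient (psi x t) y⟫)) * t ^ d
      ≤ σ ^ 2 * mvol (ball (0 : Euc d) 1) * t ^ d + μ * mvol (ball x t \ Om D u) := by
  have hadm := psi_adm ht hb
  have hs : 0 < σ / t := by positivity
  have hJ := S.Jexp hadm (-(σ / t))
  have hom : Om D (fun y => u y - -(σ / t) * psi x t y) = Om D u ∪ (ball x t \ Om D u) := by
    rw [union_sdiff_self]
    ext y
    have hu := S.hnn y
    have hp := psi_nonneg x t y
    constructor
    · rintro ⟨hy, hy2⟩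
      by_cases h0 : u y = 0
      · right
        by_contra hyb
        rw [mem_ball, not_lt, dist_eq_norm] at hyb
        apply hy2
        show u y - -(σ / t) * psi x t y = 0
        rw [psi_zero hyb, h0]; simp
      · exact Or.inl ⟨hy, h0⟩
    · rintro (⟨hy, hy2⟩ | hy)
      · refine ⟨hy, ne_of_gt ?_⟩
        have : 0 < u y := lt_of_le_of_ne hu (Ne.symm hy2)
        have : 0 ≤ σ / t * psi x t y := by positivity
        linarith
      · refine ⟨S.hBD (hb (ball_subset_closedBall hy)), ne_of_gt ?_⟩
        rw [mem_ball, dist_eq_norm] at hy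
        have := psi_pos hy
        have : 0 < σ / t * psi x t y := by positivity
        linarith
  have hvol : mvol (Om D (fun y => u y - -(σ / t) * psi x t y)) = a + mvol (ball x t \ Om D u) := by
    rw [hom, ← ha]
    unfold mvol
    rw [measure_union disjoint_sdiff_self_right (measurableSet_ball.diff S.om_open.measurableSet),
      ENNReal.toReal_add (S.om_ne_top u)
        (ne_top_of_le_ne_top measure_ball_lt_top.ne (measure_mono sdiff_subset))]
  have hZ : mvol (ball x t \ Om D u) ≤ h :=
    (mvol_mono sdiff_subset measure_ball_lt_top.ne).trans hh
  have h1 := hμ.2 _ (S.fcal hadm (-(σ / t))) (by rw [hvol]; linarith [mvol_nonneg (ball x t \ Om D u)])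
    (by rw [hvol]; linarith)
  rw [hvol, ha, hJ] at h1
  have h2 : 0 ≤ lam * ∫ y, u y * psi x t y :=
    mul_nonneg S.hlam (integral_nonneg fun y => mul_nonneg (S.hnn y) (psi_nonneg x t y))
  have h3 := S.J_psi_le x ht
  set I := ∫ y, ⟪gradient u y, gradient (psi x t) y⟫
  have h4 : (σ / t) ^ 2 * Jfun lam (psi x t) ≤ σ ^ 2 * mvol (ball (0 : Euc d) 1) * t ^ d := by
    calc _ ≤ (σ / t) ^ 2 * (mvol (ball (0 : Euc d) 1) * t ^ (d + 2)) := by gcongr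
      _ = _ := by field_simp; ring
  have h5 : 2 * σ * (-((t ^ (d + 1))⁻¹ * I)) * t ^ d = - (2 * (σ / t) * I) := by
    field_simp
    ring
  rw [h5]
  have h6 : 0 ≤ (σ / t) * (lam * ∫ y, u y * psi x t y) := by positivity
  have h7 : (-(σ / t)) ^ 2 = (σ / t) ^ 2 := by ring
  rw [h7] at h1
  linarith

/-- bound for the derivative of `MM` : if the empty part is at most `ζ t^d` -/
lemma deriv_le (S : Setup D B lam u) {a h μ : ℝ} (hμ : μ ∈ Mplus D a lam u B h) (ha : mvol (Om D u) = a)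
    {x : Euc d} {t : ℝ} (ht : 0 < t) (hb : closedBall x t ⊆ B) (hh : mvol (ball x t) ≤ h) {κ ζ : ℝ} (hκ : 0 < κ)
    (hZ : mvol (ball x t \ Om D u) ≤ ζ * t ^ d) (hζ : μ * ζ * mvol (ball (0 : Euc d) 1) ≤ κ ^ 2) :
    -((t ^ (d + 1))⁻¹ * ∫ y, ⟪gradient u y, gradient (psi x t) y⟫) ≤ κ := by
  have hω := om_pos (d := d)
  set ω := mvol (ball (0 : Euc d) 1)
  have h1 := S.outward hμ ha ht hb hh (σ := κ / ω) (by positivity)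
  set M' := -((t ^ (d + 1))⁻¹ * ∫ y, ⟪gradient u y, gradient (psi x t) y⟫)
  have h2 := mul_le_mul_of_nonneg_left hZ hμ.1
  have ht' : 0 < t ^ d := by positivity
  have h3 : 2 * (κ / ω) * M' ≤ (κ / ω) ^ 2 * ω + μ * ζ := by
    refine le_of_mul_le_mul_right ?_ ht'
    calc _ ≤ _ := h1
      _ ≤ _ := by linarith
  have h4 : 2 * κ * M' ≤ 2 * κ * κ := by
    have h5 := mul_le_mul_of_nonneg_right h3 hω.le
    have e1 : 2 * (κ / ω) * M' * ω = 2 * κ * M' := by field_simp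
    have e2 : ((κ / ω) ^ 2 * ω + μ * ζ) * ω = κ ^ 2 + μ * ζ * ω := by field_simp
    rw [e1, e2] at h5
    linarith
  exact le_of_mul_le_mul_left h4 (by positivity)

/-- growth of `MM` on an interval where the derivative is at most `κ` -/
lemma MM_growth (S : Setup D B lam u) {x : Euc d} {s t κ : ℝ} (hs : 0 ≤ s) (hst : s ≤ t) (hb : closedBall x t ⊆ B)
    (hd : ∀ r, s < r → r < t → -((r ^ (d + 1))⁻¹ * ∫ y, ⟪gradient u y, gradient (psi x r) y⟫) ≤ κ) :
    MM u x t ≤ MM u x s + κ * (t - s) := by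
  obtain ⟨hc, hder⟩ := S.MM_props (hb.trans S.hBD)
  have h := (convex_Icc s t).image_sub_le_mul_sub_of_deriv_le (f := MM u x) (C := κ)
    (hc.mono (Icc_subset_Icc_left hs)) (by
      rw [interior_Icc]; intro r hr
      exact (hder r (hs.trans_lt hr.1) hr.2).differentiableAt.differentiableWithinAt) (by
      rw [interior_Icc]; intro r hr
      rw [(hder r (hs.trans_lt hr.1) hr.2).deriv]
      exact hd r hr.1 hr.2) s (left_mem_Icc.2 hst) t (right_mem_Icc.2 hst) hst
  linarith

/-- linear growth from a zero of `u` : `A = ω (1 + μ)` -/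
lemma MM_lin (S : Setup D B lam u) {a h μ : ℝ} (hμ : μ ∈ Mplus D a lam u B h) (ha : mvol (Om D u) = a)
    {x : Euc d} {t : ℝ} (ht : 0 < t) (hb : closedBall x t ⊆ B) (hh : mvol (ball x t) ≤ h) (hx : u x = 0) :
    MM u x t ≤ mvol (ball (0 : Euc d) 1) * (1 + μ) * t := by
  have hω := om_pos (d := d)
  have h1 := S.MM_growth (s := 0) (κ := mvol (ball (0 : Euc d) 1) * (1 + μ)) le_rfl ht.le hb (by
    intro r hr hrt
    have hsub : closedBall x r ⊆ closedBall x t := closedBall_subset_closedBall hrt.le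
    refine S.deriv_le hμ ha hr (hsub.trans hb)
      ((mvol_mono (ball_subset_ball hrt.le) measure_ball_lt_top.ne).trans hh) (ζ := mvol (ball (0 : Euc d) 1))
      (by have := hμ.1; positivity) ?_ ?_
    · rw [← mvol_ball x hr]
      exact mvol_mono sdiff_subset measure_ball_lt_top.ne
    · have := hμ.1
      nlinarith [sq_nonneg (mvol (ball (0 : Euc d) 1)), mul_nonneg this (sq_nonneg (mvol (ball (0 : Euc d) 1))),
        sq_nonneg (μ * mvol (ball (0 : Euc d) 1))])
  rw [MM_zero, hx] at h1
  simpa using h1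

end Setup

def eta (x : Euc d) (ρ : ℝ) (y : Euc d) : ℝ := max 0 (min 1 (3 - 4 / ρ * ‖y - x‖))

lemma eta_nonneg (x : Euc d) (ρ : ℝ) (y : Euc d) : 0 ≤ eta x ρ y := le_max_left _ _

lemma eta_le (x : Euc d) (ρ : ℝ) (y : Euc d) : eta x ρ y ≤ 1 := max_le zero_le_one (min_le_left _ _)

lemma eta_one {x : Euc d} {ρ : ℝ} (hρ : 0 < ρ) {y : Euc d} (h : ‖y - x‖ ≤ ρ / 2) : eta x ρ y = 1 := by
  have : 4 / ρ * ‖y - x‖ ≤ 2 := by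
    calc _ ≤ 4 / ρ * (ρ / 2) := by gcongr
      _ = 2 := by field_simp; norm_num
  rw [eta, min_eq_left (by linarith), max_eq_right zero_le_one]

lemma eta_zero {x : Euc d} {ρ : ℝ} (hρ : 0 < ρ) {y : Euc d} (h : 3 * ρ / 4 ≤ ‖y - x‖) : eta x ρ y = 0 := by
  have : 3 ≤ 4 / ρ * ‖y - x‖ := by
    calc 3 = 4 / ρ * (3 * ρ / 4) := by field_simp
      _ ≤ _ := by gcongr
  rw [eta, max_eq_left ((min_le_right _ _).trans (by linarith))]

lemma eta_lip (x : Euc d) {ρ : ℝ} (hρ : 0 < ρ) : LipschitzWith (Real.toNNReal (4 / ρ)) (eta x ρ) := by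
  have h1 : LipschitzWith (Real.toNNReal (4 / ρ)) (fun y : Euc d => 3 - 4 / ρ * ‖y - x‖) := by
    refine LipschitzWith.of_dist_le_mul fun y z => ?_
    rw [Real.coe_toNNReal _ (by positivity), Real.dist_eq]
    have : 3 - 4 / ρ * ‖y - x‖ - (3 - 4 / ρ * ‖z - x‖) = - (4 / ρ * (‖y - x‖ - ‖z - x‖)) := by ring
    rw [this, abs_neg, abs_mul, abs_of_pos (by positivity)]
    gcongr
    refine (abs_norm_sub_norm_le _ _).trans ?_
    rw [dist_eq_norm]; simp
  exact (h1.const_min 1).const_max 0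

lemma eta_tsupport (x : Euc d) {ρ : ℝ} (hρ : 0 < ρ) : tsupport (eta x ρ) ⊆ ball x ρ := by
  have : tsupport (eta x ρ) ⊆ closedBall x (3 * ρ / 4) := by
    refine closure_minimal ?_ isClosed_closedBall
    intro y hy
    by_contra h
    apply hy
    rw [mem_closedBall, not_le, dist_eq_norm] at h
    exact eta_zero hρ h.le
  exact this.trans (closedBall_subset_ball (by linarith))

lemma eta_adm {B : Set (Euc d)} {x : Euc d} {ρ : ℝ} (hρ : 0 < ρ) (h : closedBall x ρ ⊆ B) :
    Adm B (eta x ρ) :=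
  ⟨⟨_, eta_lip x hρ⟩, (isCompact_closedBall x ρ).of_isClosed_subset (isClosed_tsupport _)
    ((eta_tsupport x hρ).trans ball_subset_closedBall),
    (eta_tsupport x hρ).trans (ball_subset_closedBall.trans h)⟩

namespace Setup
variable {D B : Set (Euc d)} {lam : ℝ} {u : Euc d → ℝ}

lemma adm_u_mul (S : Setup D B lam u) {x : Euc d} {ρ : ℝ} (hb : closedBall x ρ ⊆ B) {φ : Euc d → ℝ}
    (hφ : Adm B φ) (hs : tsupport φ ⊆ closedBall x ρ) : Adm B (fun y => u y * φ y) := by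
  obtain ⟨K, N, f, hf, hf0, hfN, hfu⟩ := S.ext (hb.trans S.hBD)
  have heq : (fun y => f y * φ y) = fun y => u y * φ y := by
    ext y
    by_cases hy : y ∈ tsupport φ
    · rw [hfu y (hs hy)]
    · rw [image_eq_zero_of_notMem_tsupport hy]; simp
  rw [← heq]
  exact hφ.mul hf (fun y => by rw [abs_of_nonneg (hf0 y)]; exact hfN y)

lemma J_cut (S : Setup D B lam u) {x : Euc d} {ρ δ : ℝ} (hρ : 0 < ρ) (hb : closedBall x ρ ⊆ B)
    (hδ : ∀ y ∈ closedBall x ρ, u y ≤ δ * ρ) :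
    Jfun lam (fun y => u y - 1 * (u y * eta x ρ y)) ≤
      Jfun lam u + 16 * δ ^ 2 * (mvol (ball (0 : Euc d) 1) * ρ ^ d) := by
  have hη := eta_adm hρ hb
  have hts := (eta_tsupport x hρ).trans ball_subset_closedBall
  have hη2 : Adm B (fun y => eta x ρ y * eta x ρ y) :=
    hη.mul (N := 1) (eta_lip x hρ) (fun y => by
      rw [abs_of_nonneg (eta_nonneg _ _ _)]; simpa using eta_le x ρ y)
  have hφ := S.adm_u_mul hb hη hts
  have hφ2 := S.adm_u_mul hb hη2 (tsupport_mul_subset_right.trans hts)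
  have e1 := S.euler hφ (fun y _ h => by simp [h])
  have e2 := S.euler hφ2 (fun y _ h => by simp [h])
  rw [S.Jexp hφ 1, e1]
  obtain ⟨hu1, hu2, -⟩ := S.hu
  obtain ⟨hv1, hv2, -⟩ := hφ.memH10 S.hB
  obtain ⟨hw1, hw2, -⟩ := hφ2.memH10 S.hB
  have i1 : Integrable (fun y => ‖gradient (fun y => u y * eta x ρ y) y‖ ^ 2) volume :=
    hv2.integrable_norm_pow (by norm_num)
  have i2 := integrable_inner_of hu2 hw2
  have e3 : (∫ y, (u y * eta x ρ y) ^ 2) = ∫ y, u y * (u y * (eta x ρ y * eta x ρ y)) := by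
    congr 1; ext y; ring
  have e4 : Jfun lam (fun y => u y * eta x ρ y) = ∫ y, (‖gradient (fun y => u y * eta x ρ y) y‖ ^ 2
      - ⟪gradient u y, gradient (fun y => u y * (eta x ρ y * eta x ρ y)) y⟫) := by
    rw [integral_sub i1 i2, e2, Jfun, e3]
  have h2 : Jfun lam (fun y => u y * eta x ρ y) ≤ ∫ y, (ball x ρ).indicator (fun _ => 16 * δ ^ 2) y := by
    rw [e4]
    refine integral_mono_ae (i1.sub i2) ((integrable_indicator_iff measurableSet_ball).2
        (integrableOn_const measure_ball_lt_top.ne)) ?_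
    filter_upwards [S.grad_ae hη] with y hy
    by_cases hys : y ∈ tsupport (eta x ρ)
    · have hd := hy.1 hys
      have h3 := grad_mul_at hd hy.2
      have h4 := grad_mul_at hd (hy.2.fun_mul hy.2)
      have h5 := grad_mul_at hy.2 hy.2
      rw [h3, h4, h5, indicator_of_mem (eta_tsupport x hρ hys)]
      have h6 : ‖gradient (eta x ρ) y‖ ≤ 4 / ρ := by
        have := grad_lip_le (eta_lip x hρ) y
        rwa [Real.coe_toNNReal _ (by positivity)] at this
      have h7 := hδ y (hts hys)
      have h8 := S.hnn y
      set p := gradient u y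
      set q := gradient (eta x ρ) y
      set e := eta x ρ y
      have h9 : ‖u y • q + e • p‖ ^ 2 - ⟪p, u y • (e • q + e • q) + (e * e) • p⟫ = u y ^ 2 * ‖q‖ ^ 2 := by
        rw [norm_add_sq_real]
        simp only [inner_add_right, inner_smul_right, inner_smul_left, norm_smul, mul_pow,
          Real.norm_eq_abs, sq_abs, real_inner_self_eq_norm_sq]
        rw [real_inner_comm]
        simp
        ring
      rw [h9]
      calc _ ≤ (δ * ρ) ^ 2 * (4 / ρ) ^ 2 := by gcongr
        _ = _ := by field_simp; norm_num
    · have h3 : gradient (fun y => u y * eta x ρ y) y = 0 :=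
        grad_zero_off (fun h => hys (tsupport_mul_subset_right h))
      have h4 : gradient (fun y => u y * (eta x ρ y * eta x ρ y)) y = 0 :=
        grad_zero_off (fun h => hys (tsupport_mul_subset_right (tsupport_mul_subset_right h)))
      rw [h3, h4]
      simp only [norm_zero, inner_zero_right]
      refine le_trans (by norm_num) (indicator_nonneg (fun _ _ => by positivity) _)
  rw [integral_indicator measurableSet_ball, setIntegral_const, smul_eq_mul] at h2
  have h3 : volume.real (ball x ρ) = mvol (ball x ρ) := rfl
  rw [h3, mvol_ball x hρ] at h2
  linarith

lemma inward (S : Setup D B lam u) {a h μ : ℝ} (hμ : μ ∈ Mminus D a lam u B h) (ha : mvol (Om D u) = a)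
    {x : Euc d} {ρ δ : ℝ} (hρ : 0 < ρ) (hb : closedBall x ρ ⊆ B) (hh : mvol (ball x ρ) ≤ h)
    (hδ : ∀ y ∈ closedBall x ρ, u y ≤ δ * ρ) :
    μ * mvol (Om D u ∩ ball x (ρ / 2)) ≤ 16 * δ ^ 2 * (mvol (ball (0 : Euc d) 1) * ρ ^ d) := by
  have hη := eta_adm hρ hb
  have hts := (eta_tsupport x hρ).trans ball_subset_closedBall
  have hφ := S.adm_u_mul hb hη hts
  set v := fun y => u y - 1 * (u y * eta x ρ y) with hv
  have hF := S.fcal hφ 1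
  have hJ := S.J_cut hρ hb hδ
  have h1 : Om D v ⊆ Om D u \ ball x (ρ / 2) := by
    rintro y ⟨hy, hy2⟩
    refine ⟨⟨hy, fun h0 => hy2 ?_⟩, fun hyb => hy2 ?_⟩
    · simp [hv, h0]
    · rw [mem_ball, dist_eq_norm] at hyb
      simp [hv, eta_one hρ hyb.le]
  have h2 : Om D u ⊆ Om D v ∪ ball x ρ := by
    rintro y ⟨hy, hy2⟩
    by_cases hyb : y ∈ ball x ρ
    · exact Or.inr hyb
    · left
      have : eta x ρ y = 0 := by
        by_contra hne
        exact hyb (eta_tsupport x hρ (subset_tsupport _ hne))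
      refine ⟨hy, ?_⟩
      simpa [hv, this] using hy2
  have m1 : mvol (Om D v) + mvol (Om D u ∩ ball x (ρ / 2)) ≤ a := by
    have h3 : mvol (Om D u \ ball x (ρ / 2)) + mvol (Om D u ∩ ball x (ρ / 2)) = a := by
      rw [← ha]
      unfold mvol
      rw [← ENNReal.toReal_add (ne_top_of_le_ne_top (S.om_ne_top u) (measure_mono sdiff_subset))
        (ne_top_of_le_ne_top (S.om_ne_top u) (measure_mono inter_subset_left)), measure_sdiff_add_inter _ measurableSet_ball]
    have h4 := mvol_mono h1 (ne_top_of_le_ne_top (S.om_ne_top u) (measure_mono sdiff_subset))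
    linarith
  have m2 : a ≤ mvol (Om D v) + mvol (ball x ρ) := by
    rw [← ha]
    unfold mvol
    rw [← ENNReal.toReal_add (S.om_ne_top v) measure_ball_lt_top.ne]
    exact ENNReal.toReal_mono (ENNReal.add_ne_top.2 ⟨S.om_ne_top v, measure_ball_lt_top.ne⟩)
      ((measure_mono h2).trans (measure_union_le _ _))
  have m3 := mvol_nonneg (Om D u ∩ ball x (ρ / 2))
  have h5 := hμ.2 v hF (by linarith) (by linarith)
  have h6 := mul_le_mul_of_nonneg_left m1 hμ.1
  rw [ha] at h5
  linarith

lemma int_u_le (S : Setup D B lam u) {x : Euc d} {t c : ℝ} (hb : ball x t ⊆ D) (hc : ∀ y ∈ ball x t, u y ≤ c) :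
    (∫ y in ball x t, u y) ≤ c * mvol (Om D u ∩ ball x t) := by
  have h1 : (∫ y in ball x t, u y) ≤ ∫ y in ball x t, (Om D u).indicator (fun _ => c) y := by
    refine setIntegral_mono_on (S.iu x t) ?_ measurableSet_ball fun y hy => ?_
    · exact Integrable.integrableOn ((integrable_indicator_iff S.om_open.measurableSet).2
        (integrableOn_const (S.om_ne_top u)))
    · by_cases h0 : u y = 0
      · rw [indicator_of_notMem (fun h => h.2 h0), h0]
      · have hm : y ∈ Om D u := ⟨hb hy, h0⟩
        rw [indicator_of_mem hm]; exact hc y hy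
  rw [setIntegral_indicator S.om_open.measurableSet, setIntegral_const, smul_eq_mul, mul_comm, inter_comm] at h1
  exact h1

lemma nondeg_step (S : Setup D B lam u) {a h μ : ℝ} (hμ : μ ∈ Mminus D a lam u B h) (hμ0 : 0 < μ)
    (ha : mvol (Om D u) = a)
    {x : Euc d} {ρ δ : ℝ} (hρ : 0 < ρ) (hδ0 : 0 < δ) (hb : closedBall x ρ ⊆ B) (hh : mvol (ball x ρ) ≤ h)
    (hl : lam * ρ ^ 2 ≤ 1) (hδμ : 128 * 4 ^ d * δ ^ 2 ≤ μ)
    (hδ : ∀ y ∈ closedBall x ρ, u y ≤ δ * ρ) : ∀ z ∈ closedBall x (ρ / 4), u z ≤ δ * (ρ / 4) := by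
  intro z hz
  have hω := om_pos (d := d)
  have h1 := S.inward hμ ha hρ hb hh hδ
  have hsub : closedBall z (ρ / 4) ⊆ closedBall x ρ := by
    refine closedBall_subset_closedBall' ?_
    rw [mem_closedBall] at hz; linarith
  have hsub2 : ball z (ρ / 4) ⊆ ball x (ρ / 2) := by
    refine ball_subset_ball' ?_
    rw [mem_closedBall] at hz; linarith
  have h2 := S.sub_mean (x := z) (T := ρ / 4) (by positivity) (hsub.trans hb) (by
    have := S.hlam
    have : 0 ≤ lam * ρ ^ 2 := by positivity
    nlinarith)
  have h3 := S.int_u_le (x := z) (t := ρ / 4) (c := δ * ρ)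
    (ball_subset_closedBall.trans (hsub.trans (hb.trans S.hBD)))
    (fun y hy => hδ y (hsub (ball_subset_closedBall hy)))
  have h4 : mvol (Om D u ∩ ball z (ρ / 4)) ≤ mvol (Om D u ∩ ball x (ρ / 2)) :=
    mvol_mono (inter_subset_inter_right _ hsub2) (ne_top_of_le_ne_top (S.om_ne_top u) (measure_mono inter_subset_left))
  set ω := mvol (ball (0 : Euc d) 1)
  set V := mvol (Om D u ∩ ball x (ρ / 2))
  have h5 : ω * u z * (ρ / 4) ^ d ≤ 2 * (δ * ρ * V) := by
    have : δ * ρ * mvol (Om D u ∩ ball z (ρ / 4)) ≤ δ * ρ * V := by gcongr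
    linarith
  have h6 : μ * (ω * u z * (ρ / 4) ^ d) ≤ 2 * (δ * ρ) * (16 * δ ^ 2 * (ω * ρ ^ d)) := by
    calc _ ≤ μ * (2 * (δ * ρ * V)) := by gcongr
      _ = 2 * (δ * ρ) * (μ * V) := by ring
      _ ≤ _ := by gcongr
  have h7 : (ρ / 4) ^ d = ρ ^ d / 4 ^ d := div_pow _ _ _
  have hP : 0 < ω * ρ ^ d := by positivity
  have h8 : μ * u z ≤ 32 * 4 ^ d * δ ^ 2 * (δ * ρ) := by
    refine le_of_mul_le_mul_right ?_ hP
    have h9 : (0 : ℝ) < 4 ^ d := by positivity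
    calc μ * u z * (ω * ρ ^ d) = 4 ^ d * (μ * (ω * u z * (ρ / 4) ^ d)) := by rw [h7]; field_simp
      _ ≤ 4 ^ d * (2 * (δ * ρ) * (16 * δ ^ 2 * (ω * ρ ^ d))) := by gcongr
      _ = _ := by ring
  have h9 : 32 * 4 ^ d * δ ^ 2 * (δ * ρ) ≤ μ / 4 * (δ * ρ) := by
    gcongr; linarith
  refine le_of_mul_le_mul_left (a := μ) ?_ hμ0
  linarith

lemma nondeg (S : Setup D B lam u) {a h μ : ℝ} (hμ : μ ∈ Mminus D a lam u B h) (hμ0 : 0 < μ)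
    (ha : mvol (Om D u) = a)
    {x : Euc d} {ρ δ : ℝ} (hρ : 0 < ρ) (hδ0 : 0 < δ) (hb : closedBall x ρ ⊆ B) (hh : mvol (ball x ρ) ≤ h)
    (hl : lam * ρ ^ 2 ≤ 1) (hδμ : 128 * 4 ^ d * δ ^ 2 ≤ μ) (hx : u x ≠ 0) :
    ∃ z ∈ closedBall x ρ, δ * ρ < u z := by
  by_contra! hcon
  have key : ∀ n : ℕ, ∀ z ∈ closedBall x (ρ / 4 ^ n), u z ≤ δ * (ρ / 4 ^ n) := by
    intro n
    induction n with
    | zero => simpa using hcon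
    | succ n ih =>
      have e : ρ / 4 ^ (n + 1) = ρ / 4 ^ n / 4 := by rw [pow_succ]; field_simp
      have hle : ρ / 4 ^ n ≤ ρ := div_le_self hρ.le (one_le_pow₀ (by norm_num))
      have hp : 0 < ρ / 4 ^ n := by positivity
      rw [e]
      refine S.nondeg_step hμ hμ0 ha hp hδ0 ((closedBall_subset_closedBall hle).trans hb)
        ((mvol_mono (ball_subset_ball hle) measure_ball_lt_top.ne).trans hh) ?_ hδμ ih
      refine le_trans ?_ hl
      have := S.hlam
      gcongr
  have hpos : 0 < u x := lt_of_le_of_ne (S.hnn x) hx.symm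
  have hlim : Tendsto (fun n : ℕ => δ * (ρ / 4 ^ n)) atTop (𝓝 0) := by
    have := (tendsto_pow_atTop_nhds_zero_of_lt_one (r := (1 / 4 : ℝ)) (by norm_num) (by norm_num)).const_mul (δ * ρ)
    rw [mul_zero] at this
    refine this.congr fun n => ?_
    rw [div_pow, one_pow]; ring
  have := ge_of_tendsto' hlim (fun n => key n x (mem_closedBall_self (by positivity)))
  linarith

end Setup

namespace Setup
variable {D B : Set (Euc d)} {lam : ℝ} {u : Euc d → ℝ}

lemma int_le_int (S : Setup D B lam u) {x y : Euc d} {s t : ℝ} (h : ball x s ⊆ ball y t) :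
    (∫ z in ball x s, u z) ≤ ∫ z in ball y t, u z :=
  setIntegral_mono_set (S.iu y t) (Eventually.of_forall fun z => S.hnn z) (HasSubset.Subset.eventuallyLE h)

lemma lower_core (S : Setup D B lam u) {a h μ : ℝ} (hμ : μ ∈ Mplus D a lam u B h) (ha : mvol (Om D u) = a)
    {z : Euc d} {τ : ℝ} (hτ : 0 < τ) (hb : closedBall z (3 * τ) ⊆ B) (hh : mvol (ball z (2 * τ)) ≤ h)
    (hl : lam * τ ^ 2 ≤ 1) (hz : 4 * 2 ^ d * (1 + μ) * τ < u z) : ball z τ ⊆ Om D u := by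
  intro x hx
  rw [mem_ball] at hx
  have hω := om_pos (d := d)
  have hxB : closedBall x (2 * τ) ⊆ B :=
    (closedBall_subset_closedBall' (by linarith)).trans hb
  refine ⟨S.hBD (hxB (mem_closedBall_self (by positivity))), fun h0 => ?_⟩
  have h1 := S.sub_mean hτ ((closedBall_subset_closedBall (by linarith)).trans hb) hl
  have h2 := S.int_le_int (x := z) (y := x) (s := τ) (t := 2 * τ)
    (ball_subset_ball' (by rw [dist_comm]; linarith))
  rw [int_ball_scale u x (by positivity : 0 < 2 * τ)] at h2
  change _ ≤ (2 * τ) ^ d * MM u x (2 * τ) at h2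
  have h3 := S.MM_lin hμ ha (by positivity : 0 < 2 * τ) hxB
    (by rw [mvol_ball _ (by positivity)] at hh ⊢; exact hh) h0
  set ω := mvol (ball (0 : Euc d) 1)
  have hP : 0 < ω * τ ^ d := by positivity
  have h4 : u z ≤ 4 * 2 ^ d * (1 + μ) * τ := by
    refine le_of_mul_le_mul_left ?_ hP
    calc ω * τ ^ d * u z = ω * u z * τ ^ d := by ring
      _ ≤ 2 * ((2 * τ) ^ d * (ω * (1 + μ) * (2 * τ))) := by
        refine h1.trans (mul_le_mul_of_nonneg_left (h2.trans ?_) (by norm_num))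
        gcongr
      _ = _ := by rw [mul_pow]; ring
  linarith

lemma upper_core (S : Setup D B lam u) {a h μ : ℝ} (hμ : μ ∈ Mplus D a lam u B h) (ha : mvol (Om D u) = a)
    {x z : Euc d} {r c η ζ : ℝ} (hr : 0 < r) (hb : ball x r ⊆ B) (hh : mvol (ball x r) ≤ h)
    (hl : lam * r ^ 2 ≤ 1) (hx : u x = 0) (hzx : dist z x ≤ r / 4) (hc : 0 < c)
    (hz : c * r * (2 * 4 ^ d) ≤ mvol (ball (0 : Euc d) 1) * u z)
    (hη : 0 < η) (hη4 : η ≤ 1 / 4) (hηA : mvol (ball (0 : Euc d) 1) * (1 + μ) * η ≤ c / 3)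
    (hζ : μ * ζ * mvol (ball (0 : Euc d) 1) ≤ c ^ 2) (hζ0 : 0 < ζ) :
    ζ * η ^ d * r ^ d < mvol (ball x r \ Om D u) := by
  by_contra! hcon
  have hω := om_pos (d := d)
  have hbx : closedBall x (r / 2) ⊆ B := (closedBall_subset_ball (by linarith)).trans hb
  have hbz : closedBall z (r / 8) ⊆ B := (closedBall_subset_ball' (by linarith)).trans hb
  have h1 := S.sub_mean (by positivity : 0 < r / 8) hbz (by
    have := S.hlam
    have : 0 ≤ lam * r ^ 2 := by positivity
    nlinarith)
  have h2 := S.int_le_int (x := z) (y := x) (s := r / 8) (t := r / 2) (ball_subset_ball' (by linarith))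
  rw [int_ball_scale u x (by positivity : 0 < r / 2)] at h2
  change _ ≤ (r / 2) ^ d * MM u x (r / 2) at h2
  set ω := mvol (ball (0 : Euc d) 1)
  have hlow : c * r ≤ MM u x (r / 2) := by
    have e : (r / 2) ^ d = 4 ^ d * (r / 8) ^ d := by rw [← mul_pow]; congr 1; ring
    have hp : 0 < 2 * 4 ^ d * (r / 8) ^ d := by positivity
    refine le_of_mul_le_mul_right ?_ hp
    calc c * r * (2 * 4 ^ d * (r / 8) ^ d) = c * r * (2 * 4 ^ d) * (r / 8) ^ d := by ring
      _ ≤ ω * u z * (r / 8) ^ d := by gcongr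
      _ ≤ 2 * ((r / 2) ^ d * MM u x (r / 2)) := by linarith
      _ = _ := by rw [e]; ring
  have hηr : 0 < η * r := by positivity
  have hηr2 : η * r ≤ r / 4 := by nlinarith
  have h3 := S.MM_lin hμ ha hηr ((closedBall_subset_closedBall (by linarith)).trans hbx)
    ((mvol_mono (ball_subset_ball (by linarith)) measure_ball_lt_top.ne).trans hh) hx
  have h4 := S.MM_growth (x := x) (s := η * r) (t := r / 2) (κ := c) hηr.le (by linarith) hbx (by
    intro t ht1 ht2
    have ht : 0 < t := hηr.trans ht1
    refine S.deriv_le hμ ha ht ((closedBall_subset_closedBall ht2.le).trans hbx)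
      ((mvol_mono (ball_subset_ball (by linarith)) measure_ball_lt_top.ne).trans hh) hc (ζ := ζ) ?_ hζ
    calc mvol (ball x t \ Om D u) ≤ mvol (ball x r \ Om D u) :=
          mvol_mono (sdiff_subset_sdiff_left (ball_subset_ball (by linarith)))
            (ne_top_of_le_ne_top measure_ball_lt_top.ne (measure_mono sdiff_subset))
      _ ≤ ζ * (η * r) ^ d := by rw [mul_pow, ← mul_assoc]; exact hcon
      _ ≤ _ := by gcongr)
  have h5 : ω * (1 + μ) * (η * r) ≤ c / 3 * r := by
    calc _ = ω * (1 + μ) * η * r := by ring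
      _ ≤ _ := by gcongr
  have h6 : 0 < c * r := by positivity
  have h7 : 0 < c * (η * r) := by positivity
  linarith

lemma core (S : Setup D B lam u) (hd : d ≠ 0) {a h μm μp : ℝ} (hh : 0 < h) (hm : μm ∈ Mminus D a lam u B h)
    (hm0 : 0 < μm) (hp : μp ∈ Mplus D a lam u B h) (ha : mvol (Om D u) = a) :
    ∃ C₁ C₂ : ℝ, 0 < C₁ ∧ C₁ ≤ C₂ ∧ C₂ < 1 ∧ ∃ r₀ > (0 : ℝ),
      ∀ (x₀ : Euc d) (r : ℝ), x₀ ∈ frontier (Om D u) → 0 < r → r ≤ r₀ →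
        ball x₀ r ⊆ B →
        C₁ ≤ mvol (ball x₀ r ∩ Om D u) / mvol (ball x₀ r) ∧
        mvol (ball x₀ r ∩ Om D u) / mvol (ball x₀ r) ≤ C₂ := by
  have hω := om_pos (d := d)
  have hlam := S.hlam
  have hp0 := hp.1
  set ω := mvol (ball (0 : Euc d) 1) with hωdef
  set δ := Real.sqrt (μm / (128 * 4 ^ d)) with hδ
  have hδ0 : 0 < δ := Real.sqrt_pos.2 (by positivity)
  have hδμ : 128 * 4 ^ d * δ ^ 2 ≤ μm := by
    rw [hδ, Real.sq_sqrt (by positivity)]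
    exact (mul_div_cancel₀ μm (by positivity)).le
  set c := min (1 / 8) (δ / (64 * 2 ^ d * (1 + μp))) with hc
  have hc0 : 0 < c := by positivity
  have hc8 : c ≤ 1 / 8 := min_le_left _ _
  have hcδ : 4 * 2 ^ d * (1 + μp) * c ≤ δ / 16 := by
    calc _ ≤ 4 * 2 ^ d * (1 + μp) * (δ / (64 * 2 ^ d * (1 + μp))) := by
          gcongr; exact min_le_right _ _
      _ = _ := by field_simp; norm_num
  set c' := ω * δ / (16 * 4 ^ d) with hc'
  have hc'0 : 0 < c' := by positivity
  set η := min (1 / 4) (c' / (3 * (ω * (1 + μp)))) with hη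
  have hη0 : 0 < η := by positivity
  have hηA : ω * (1 + μp) * η ≤ c' / 3 := by
    calc _ ≤ ω * (1 + μp) * (c' / (3 * (ω * (1 + μp)))) := by
          gcongr; exact min_le_right _ _
      _ = _ := by field_simp
  set ζ := c' ^ 2 / ((1 + μp) * ω) with hζ
  have hζ0 : 0 < ζ := by positivity
  have hζω : μp * ζ * ω ≤ c' ^ 2 := by
    calc _ ≤ (1 + μp) * ζ * ω := by gcongr; linarith
      _ = _ := by rw [hζ]; field_simp
  refine ⟨min (c ^ d) (1 / 2), max (1 - ζ * η ^ d / ω) (1 / 2), by positivity,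
    (min_le_right _ _).trans (le_max_right _ _), max_lt ?_ (by norm_num),
    min 1 (min (1 / (lam + 1)) (h / ω)), by positivity, ?_⟩
  · have : 0 < ζ * η ^ d / ω := by positivity
    linarith
  intro x r hx hr hrr hb
  have hr1 : r ≤ 1 := hrr.trans (min_le_left _ _)
  have hr2 : r ≤ 1 / (lam + 1) := hrr.trans ((min_le_right _ _).trans (min_le_left _ _))
  have hr3 : r ≤ h / ω := hrr.trans ((min_le_right _ _).trans (min_le_right _ _))
  have hlr : lam * r ^ 2 ≤ 1 := by
    rw [le_div_iff₀ (by positivity)] at hr2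
    nlinarith
  have hvr : mvol (ball x r) ≤ h := by
    rw [mvol_ball x hr]
    have h1 : r ^ d ≤ r := pow_le_of_le_one hr.le hr1 hd
    rw [le_div_iff₀ hω] at hr3
    nlinarith
  have hxD : x ∈ D := S.hBD (hb (mem_ball_self hr))
  have hux : u x = 0 := by
    by_contra hne
    rw [S.om_open.frontier_eq] at hx
    exact hx.2 ⟨hxD, hne⟩
  obtain ⟨y, hyΩ, hyx⟩ := Metric.mem_closure_iff.1 (frontier_subset_closure hx) (r / 8) (by positivity)
  have hyb : closedBall y (r / 8) ⊆ ball x r := closedBall_subset_ball' (by rw [dist_comm]; linarith)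
  have hlt : ∀ s, 0 ≤ s → s ≤ r → lam * s ^ 2 ≤ 1 := by
    intro s hs hsr
    refine le_trans ?_ hlr
    gcongr
  have hvt : ∀ (w : Euc d) s, 0 < s → s ≤ r → mvol (ball w s) ≤ h := by
    intro w s hs hsr
    refine le_trans ?_ hvr
    rw [mvol_ball w hs, mvol_ball x hr]
    gcongr
  obtain ⟨z, hzy, hz⟩ := S.nondeg hm hm0 ha (x := y) (ρ := r / 8) (by positivity) hδ0 (hyb.trans hb)
    (hvt _ _ (by positivity) (by linarith)) (hlt _ (by positivity) (by linarith)) hδμ hyΩ.2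
  rw [mem_closedBall] at hzy
  have hzx : dist z x ≤ r / 4 := by
    have := dist_triangle z y x
    rw [dist_comm y x] at this
    linarith
  have hcr : c * r ≤ r / 8 := by nlinarith
  have hV : mvol (ball x r) = ω * r ^ d := mvol_ball x hr
  have hVp : 0 < ω * r ^ d := by positivity
  constructor
  · refine (min_le_left _ _).trans ?_
    have hlow := S.lower_core hp ha (z := z) (τ := c * r) (by positivity)
      ((closedBall_subset_ball' (by linarith)).trans hb) (hvt _ _ (by positivity) (by linarith))
      (hlt _ (by positivity) (by linarith)) (by
        calc _ = 4 * 2 ^ d * (1 + μp) * c * r := by ring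
          _ ≤ δ / 16 * r := by gcongr
          _ ≤ δ * (r / 8) := by nlinarith [mul_pos hδ0 hr]
          _ < u z := hz)
    have h1 : mvol (ball z (c * r)) ≤ mvol (ball x r ∩ Om D u) :=
      mvol_mono (subset_inter (ball_subset_ball' (by linarith)) hlow)
        (ne_top_of_le_ne_top measure_ball_lt_top.ne (measure_mono inter_subset_left))
    rw [mvol_ball z (by positivity), mul_pow] at h1
    rw [hV, le_div_iff₀ hVp]
    linarith
  · refine le_trans ?_ (le_max_left _ _)
    have hup := S.upper_core hp ha hr hb hvr hlr hux hzx hc'0 (by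
      calc c' * r * (2 * 4 ^ d) = ω * (δ * (r / 8)) := by rw [hc']; field_simp; norm_num
        _ ≤ _ := by gcongr) hη0 (min_le_left _ _) hηA hζω hζ0
    have h1 : mvol (ball x r ∩ Om D u) + mvol (ball x r \ Om D u) = ω * r ^ d := by
      rw [← hV]
      unfold mvol
      rw [← ENNReal.toReal_add (ne_top_of_le_ne_top measure_ball_lt_top.ne (measure_mono inter_subset_left))
        (ne_top_of_le_ne_top measure_ball_lt_top.ne (measure_mono sdiff_subset)),
        measure_inter_add_sdiff _ S.om_open.measurableSet]
    rw [hV, div_le_iff₀ hVp]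
    have h2 : (1 - ζ * η ^ d / ω) * (ω * r ^ d) = ω * r ^ d - ζ * η ^ d * r ^ d := by field_simp
    rw [h2]
    linarith

end Setup

/-- Density estimates: there are `0 < C₁ ≤ C₂ < 1` and `r₀ > 0` such that for
every ball `B(x₀,r) ⊆ B` with `x₀ ∈ ∂Ω_u` and `r ≤ r₀`,
`C₁ ≤ |B(x₀,r) ∩ Ω_u| / |B(x₀,r)| ≤ C₂`. -/
theorem density_estimates
    {d : ℕ} (D : Set (Euc d)) (a lama R : ℝ) (xc : Euc d) (u : Euc d → ℝ)
    (hD : IsOpen D) (hDb : Bornology.IsBounded D) (hDc : IsConnected D)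
    (ha : 0 < a) (ha' : a < mvol D)
    (hlam : lama = lamOpt D a) (hu : IsJMinimizer D a lama u)
    (hnn : ∀ x, 0 ≤ u x) (hlip : LocLipOn D u)
    (hR : 0 < R) (hball : ball xc R ⊆ D) (hxc : xc ∈ frontier (Om D u) ∩ D)
    (hpen : ∃ Λ > (0 : ℝ), ∃ h₀ > (0 : ℝ), ∀ h : ℝ, 0 < h → h < h₀ →
      (Mplus D a lama u (ball xc R) h).Nonempty ∧
      0 < muMinus D a lama u (ball xc R) h ∧
      muMinus D a lama u (ball xc R) h ≤ Λ ∧ Λ ≤ muPlus D a lama u (ball xc R) h) :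
    ∃ C₁ C₂ : ℝ, 0 < C₁ ∧ C₁ ≤ C₂ ∧ C₂ < 1 ∧ ∃ r₀ > (0 : ℝ),
      ∀ (x₀ : Euc d) (r : ℝ), x₀ ∈ frontier (Om D u) → 0 < r → r ≤ r₀ →
        ball x₀ r ⊆ ball xc R →
        C₁ ≤ mvol (ball x₀ r ∩ Om D u) / mvol (ball x₀ r) ∧
        mvol (ball x₀ r ∩ Om D u) / mvol (ball x₀ r) ≤ C₂ := by
  have hlam0 : 0 ≤ lama := by
    rw [hlam]
    refine Real.sInf_nonneg ?_
    rintro t ⟨Ω, -, -, -, rfl⟩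
    refine Real.sInf_nonneg ?_
    rintro t ⟨v, -, -, rfl⟩
    exact integral_nonneg fun _ => by positivity
  have S : Setup D (ball xc R) lama u := by
    refine ⟨hD, isOpen_ball, hball, hu.1, hnn, hlip, hlam0, hDb.measure_lt_top.ne, ?_⟩
    intro w hw hw2
    exact hu.2.2 w hw (hw2.trans hu.2.1)
  obtain ⟨Λ, hΛ, h₀, hh₀, hp⟩ := hpen
  have haeq : mvol (Om D u) = a := by
    refine le_antisymm hu.2.1 ?_
    by_contra! hlt
    set h := min (h₀ / 2) ((a - mvol (Om D u)) / 2) with hh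
    have hpos : 0 < h := lt_min (by positivity) (by linarith)
    have hh1 : h < h₀ := (min_le_left _ _).trans_lt (by linarith)
    have hh2 : h ≤ (a - mvol (Om D u)) / 2 := min_le_right _ _
    obtain ⟨-, h1, -⟩ := hp h hpos hh1
    have hnb : ¬ BddAbove (Mminus D a lama u (ball xc R) h) := by
      rintro ⟨M, hM⟩
      have hmem : |M| + 1 ∈ Mminus D a lama u (ball xc R) h := by
        refine ⟨by positivity, fun v hv hv1 hv2 => ?_⟩
        have h2 := hu.2.2 v hv.1 hv2
        have h3 : mvol (Om D u) ≤ mvol (Om D v) := by linarith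
        have h4 : (|M| + 1) * mvol (Om D u) ≤ (|M| + 1) * mvol (Om D v) := by gcongr
        linarith
      have := hM hmem
      linarith [le_abs_self M]
    rw [muMinus, Real.sSup_of_not_bddAbove hnb] at h1
    exact lt_irrefl _ h1
  obtain ⟨⟨μp, hμp⟩, h1, -⟩ := hp (h₀ / 2) (by positivity) (by linarith)
  have hne : (Mminus D a lama u (ball xc R) (h₀ / 2)).Nonempty := by
    by_contra hemp
    rw [not_nonempty_iff_eq_empty] at hemp
    rw [muMinus, hemp, Real.sSup_empty] at h1
    exact lt_irrefl _ h1
  obtain ⟨μm, hμm, hμm0⟩ := exists_lt_of_lt_csSup hne h1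
  have hd : d ≠ 0 := by
    rintro rfl
    have h2 := hxc.1
    rw [S.om_open.frontier_eq] at h2
    obtain ⟨y, hy⟩ := closure_nonempty_iff.1 ⟨xc, h2.1⟩
    exact h2.2 (Subsingleton.elim y xc ▸ hy)
  exact S.core hd (by positivity) hμm hμm0 hμp haeq

end
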